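/- arXiv:0806.3463 — 2 statements merged into one kernel-verified Lean document; each statement's English description precedes it below -/
import Mathlib

section
/- Let q be a power of a prime p. For all nonnegative integers e and i, if the power sum S_e(i) over monic polynomials of degree e vanishes, then S_{e+1}(i) also vanishes: S_e(i) = 0 ⟹ S_{e+1}(i) = 0. -/
open Polynomial

/-- An enumeration, for every residue class `t` modulo `n`, of positions in that class, in which
every position occurs at most `p - 1` times. -/
structure Ranking (p n : ℕ) where
  pos : ZMod n → ℕ → ℕ
  mono : ∀ t, Monotone (pos t)
  cast_pos : ∀ t ρ, (pos t ρ : ZMod n) = t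
  gap : ∀ t ρ, pos t ρ + n ≤ pos t (ρ + (p - 1))

namespace Ranking

variable {p n : ℕ} [NeZero n] (R : Ranking p n)

/-- The first `r t` tokens of each class `t`. -/
def tok (r : ZMod n → ℕ) : Finset (Σ _ : ZMod n, ℕ) :=
  Finset.univ.sigma fun t => Finset.range (r t)

lemma mem_tok {r : ZMod n → ℕ} {x : Σ _ : ZMod n, ℕ} : x ∈ tok r ↔ x.2 < r x.1 := by
  simp [tok]

/-- The total weight of the first `r t` tokens of each class `t`. -/
def V (r : ZMod n → ℕ) : ℕ := ∑ x ∈ tok r, p ^ R.pos x.1 x.2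

lemma V_eq_sum (r : ZMod n → ℕ) : R.V r = ∑ t, ∑ ρ ∈ Finset.range (r t), p ^ R.pos t ρ := by
  simp [V, tok, Finset.sum_sigma]

lemma pos_ne {p n : ℕ} (R : Ranking p n) {s t : ZMod n} (h : s ≠ t) (ρ σ : ℕ) :
    R.pos s ρ ≠ R.pos t σ := by
  intro e
  apply h
  rw [← R.cast_pos s ρ, e, R.cast_pos]

lemma card_fiber_le (E : Finset (Σ _ : ZMod n, ℕ)) (κ : ℕ) :
    (E.filter fun x => R.pos x.1 x.2 = κ).card ≤ p - 1 := by
  set G := E.filter fun x => R.pos x.1 x.2 = κ with hG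
  rcases G.eq_empty_or_nonempty with h | h
  · simp [h]
  obtain ⟨x, hx, hmin⟩ := Finset.exists_min_image G (fun x => x.2) h
  have hcl : ∀ y ∈ G, y.1 = x.1 := by
    intro y hy
    by_contra hne
    apply R.pos_ne hne y.2 x.2
    rw [(Finset.mem_filter.1 hy).2, (Finset.mem_filter.1 hx).2]
  have hcard : (G.image fun y => y.2).card = G.card := by
    apply Finset.card_image_of_injOn
    rintro ⟨a, b⟩ ha ⟨c, d⟩ hc hbd
    have h1 := hcl _ ha
    have h2 := hcl _ hc
    simp only at h1 h2 hbd
    rw [h1, h2, hbd]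
  rw [← hcard]
  calc _ ≤ (Finset.Ico x.2 (x.2 + (p - 1))).card := by
        apply Finset.card_le_card
        intro ρ hρ
        obtain ⟨y, hy, rfl⟩ := Finset.mem_image.1 hρ
        rw [Finset.mem_Ico]
        refine ⟨hmin y hy, ?_⟩
        by_contra hge
        have h1 := R.mono x.1 (not_lt.1 hge)
        have h2 := R.gap x.1 x.2
        have h3 := (Finset.mem_filter.1 hy).2
        have h4 := (Finset.mem_filter.1 hx).2
        rw [hcl y hy] at h3
        have := NeZero.pos n
        omega
    _ = p - 1 := by simp

lemma sum_lt_pow (hp : 2 ≤ p) (E : Finset (Σ _ : ZMod n, ℕ)) (K : ℕ)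
    (h : ∀ x ∈ E, R.pos x.1 x.2 < K) : ∑ x ∈ E, p ^ R.pos x.1 x.2 < p ^ K := by
  have hmaps : ∀ x ∈ E, R.pos x.1 x.2 ∈ Finset.range K := fun x hx => Finset.mem_range.2 (h x hx)
  rw [← Finset.sum_fiberwise_of_maps_to hmaps]
  have h1 : ∀ κ ∈ Finset.range K,
      ∑ x ∈ E with R.pos x.1 x.2 = κ, p ^ R.pos x.1 x.2 ≤ (p - 1) * p ^ κ := by
    intro κ _
    rw [Finset.sum_congr rfl (g := fun _ => p ^ κ)
      (fun x hx => by rw [(Finset.mem_filter.1 hx).2]), Finset.sum_const, smul_eq_mul]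
    exact Nat.mul_le_mul_right _ (R.card_fiber_le E κ)
  refine (Finset.sum_le_sum h1).trans_lt ?_
  rw [← Finset.mul_sum]
  have := Nat.geomSum_eq hp K
  have h2 := Nat.sub_one_dvd_pow_sub_one p K
  have h3 : 0 < p ^ K := by positivity
  rw [this, Nat.mul_div_cancel' (by simpa using h2)]
  omega

lemma V_lt (hp : 2 ≤ p) {a b : ZMod n → ℕ} (K : ℕ)
    (hb : ∃ t ρ, a t ≤ ρ ∧ ρ < b t ∧ K ≤ R.pos t ρ)
    (ha : ∀ t ρ, b t ≤ ρ → ρ < a t → R.pos t ρ < K) : R.V a < R.V b := by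
  obtain ⟨t, ρ, h1, h2, h3⟩ := hb
  apply Finset.sum_sdiff_lt_sum_sdiff.1
  have hlt : ∑ x ∈ tok a \ tok b, p ^ R.pos x.1 x.2 < p ^ K := by
    apply R.sum_lt_pow hp
    intro x hx
    simp only [Finset.mem_sdiff, mem_tok, not_lt] at hx
    exact ha _ _ hx.2 hx.1
  refine hlt.trans_le ((Nat.pow_le_pow_right (by omega) h3).trans ?_)
  exact Finset.single_le_sum (f := fun x : (Σ _ : ZMod n, ℕ) => p ^ R.pos x.1 x.2)
    (a := ⟨t, ρ⟩) (fun _ _ => Nat.zero_le _) (by simp [mem_tok]; omega)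

lemma V_mono {a b : ZMod n → ℕ} (h : ∀ t, a t ≤ b t) : R.V a ≤ R.V b := by
  apply Finset.sum_le_sum_of_subset
  intro x hx
  rw [mem_tok] at *
  exact hx.trans_le (h _)

lemma exists_top_diff (hp : 2 ≤ p) {g m : ZMod n → ℕ} (h : R.V g < R.V m) :
    ∃ s, g s < m s ∧ ∀ t, t ≠ s → ∀ ρ, min (g t) (m t) ≤ ρ → ρ < max (g t) (m t) →
      R.pos t ρ < R.pos s (m s - 1) := by
  set D := (tok g \ tok m) ∪ (tok m \ tok g) with hD
  have hmem : ∀ x, x ∈ D ↔ (min (g x.1) (m x.1) ≤ x.2 ∧ x.2 < max (g x.1) (m x.1)) := by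
    intro x
    simp only [hD, Finset.mem_union, Finset.mem_sdiff, mem_tok]
    omega
  have hne : D.Nonempty := by
    rw [Finset.nonempty_iff_ne_empty]
    intro he
    have hgm : g = m := by
      funext t
      by_contra hne
      have : (⟨t, min (g t) (m t)⟩ : Σ _ : ZMod n, ℕ) ∈ D := by
        rw [hmem]; simp only; omega
      rw [he] at this
      simp at this
    rw [hgm] at h
    exact lt_irrefl _ h
  obtain ⟨⟨s, ρ⟩, hx, hmax⟩ := Finset.exists_max_image D (fun x => R.pos x.1 x.2) hne
  have hx' := (hmem _).1 hx
  simp only at hx'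
  have hlt : ∀ t, t ≠ s → ∀ σ, min (g t) (m t) ≤ σ → σ < max (g t) (m t) →
      R.pos t σ < R.pos s ρ := fun t ht σ h1 h2 =>
    lt_of_le_of_ne (hmax ⟨t, σ⟩ ((hmem _).2 ⟨h1, h2⟩)) (R.pos_ne ht _ _)
  rcases lt_or_ge (g s) (m s) with hs | hs
  · refine ⟨s, hs, fun t ht σ h1 h2 => (hlt t ht σ h1 h2).trans_le (R.mono s (by omega))⟩
  · exfalso
    apply absurd h (not_lt.2 (le_of_lt _))
    apply R.V_lt hp (R.pos s ρ) ⟨s, ρ, by omega, by omega, le_rfl⟩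
    intro t σ h1 h2
    by_cases ht : t = s
    · subst ht; omega
    · exact hlt t ht σ (by omega) (by omega)

lemma exists_le_pos (t : ZMod n) (K : ℕ) : ∃ ρ, K ≤ R.pos t ρ := by
  induction K with
  | zero => exact ⟨0, Nat.zero_le _⟩
  | succ K ih =>
    obtain ⟨ρ, h⟩ := ih
    have := R.gap t ρ
    have := NeZero.pos n
    exact ⟨ρ + (p - 1), by omega⟩

lemma exists_threshold (t : ZMod n) (K : ℕ) :
    ∃ U, ∀ ρ, R.pos t ρ < K ↔ ρ < U := by
  refine ⟨Nat.find (R.exists_le_pos t K), fun ρ => ?_⟩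
  constructor
  · intro h
    by_contra hge
    have := R.mono t (not_lt.1 hge)
    have := Nat.find_spec (R.exists_le_pos t K)
    omega
  · intro h
    have := Nat.find_min (R.exists_le_pos t K) h
    omega

lemma pos_add_mul_le {p n : ℕ} (R : Ranking p n) (t : ZMod n) (ρ b : ℕ) :
    R.pos t ρ + n * b ≤ R.pos t (ρ + (p - 1) * b) := by
  induction b with
  | zero => simp
  | succ b ih =>
    have := R.gap t (ρ + (p - 1) * b)
    rw [mul_add, mul_add, ← add_assoc, ← add_assoc, mul_one, mul_one]
    omega

end Ranking

/-- The cyclic base-`p` combination `∑_{l < n} p ^ l * c (j + l)`. -/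
def lam (p : ℕ) {n : ℕ} (c : ZMod n → ℤ) (j : ZMod n) : ℤ :=
  ∑ l ∈ Finset.range n, (p : ℤ) ^ l * c (j + l)

/-- The count vector attached to `w`. -/
def cnt (p : ℕ) {n : ℕ} (w : ZMod n → ℤ) (t : ZMod n) : ℤ := p * w (t + 1) - w t

section lam

variable {p n : ℕ}

lemma lam_succ (c : ZMod n → ℤ) (t : ZMod n) :
    p * lam p c (t + 1) = lam p c t + ((p : ℤ) ^ n - 1) * c t := by
  have h1 := Finset.sum_range_succ (fun l : ℕ => (p : ℤ) ^ l * c (t + l)) n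
  have h2 := Finset.sum_range_succ' (fun l : ℕ => (p : ℤ) ^ l * c (t + l)) n
  have h3 : (p : ℤ) * lam p c (t + 1) =
      ∑ l ∈ Finset.range n, (p : ℤ) ^ (l + 1) * c (t + ((l + 1 : ℕ) : ZMod n)) := by
    rw [lam, Finset.mul_sum]
    refine Finset.sum_congr rfl fun l _ => ?_
    rw [show t + 1 + (l : ZMod n) = t + ((l + 1 : ℕ) : ZMod n) by push_cast; ring]
    ring
  simp only [CharP.cast_eq_zero, Nat.cast_zero, add_zero, pow_zero, one_mul] at h1 h2
  rw [h3, lam]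
  linarith

lemma lam_cnt (w : ZMod n → ℤ) (j : ZMod n) : lam p (cnt p w) j = ((p : ℤ) ^ n - 1) * w j := by
  have h := Finset.sum_range_sub (fun l : ℕ => (p : ℤ) ^ l * w (j + l)) n
  simp only [CharP.cast_eq_zero, Nat.cast_zero, add_zero, pow_zero, one_mul] at h
  rw [lam, sub_mul, one_mul, ← h]
  refine Finset.sum_congr rfl fun l _ => ?_
  rw [cnt, show j + (l : ZMod n) + 1 = j + ((l + 1 : ℕ) : ZMod n) by push_cast; ring]
  ring

lemma lam_mono {c d : ZMod n → ℤ} (h : ∀ t, c t ≤ d t) (j : ZMod n) : lam p c j ≤ lam p d j :=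
  Finset.sum_le_sum fun _ _ => mul_le_mul_of_nonneg_left (h _) (by positivity)

lemma lam_eq_sum [NeZero n] (c : ZMod n → ℤ) (j : ZMod n) :
    lam p c j = ∑ t, (p : ℤ) ^ (t - j).val * c t := by
  symm
  rw [lam]
  refine Finset.sum_bij (fun t _ => (t - j).val) ?_ ?_ ?_ ?_
  · intro t _
    exact Finset.mem_range.2 (ZMod.val_lt _)
  · intro a _ b _ h
    simpa using ZMod.val_injective n h
  · intro l hl
    exact ⟨j + l, Finset.mem_univ _, by simp [ZMod.val_cast_of_lt (Finset.mem_range.1 hl)]⟩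
  · intro t _
    simp

end lam

/-- The largest `w ≤ u` with nonnegative counts. -/
def cl (p : ℕ) {n : ℕ} [NeZero n] (u : ZMod n → ℤ) (t : ZMod n) : ℤ :=
  (Finset.range n).inf' (Finset.nonempty_range_iff.2 (NeZero.ne n))
    fun l => (p : ℤ) ^ l * u (t + l)

section cl

variable {p n : ℕ} [NeZero n] {u v : ZMod n → ℤ}

lemma cl_le_mul (u : ZMod n → ℤ) (t : ZMod n) {l : ℕ} (hl : l < n) :
    cl p u t ≤ (p : ℤ) ^ l * u (t + l) :=
  Finset.inf'_le _ (Finset.mem_range.2 hl)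

lemma cl_le (u : ZMod n → ℤ) (t : ZMod n) : cl p u t ≤ u t := by
  simpa using cl_le_mul (p := p) u t (NeZero.pos n)

lemma exists_cl_eq (u : ZMod n → ℤ) (t : ZMod n) :
    ∃ l < n, cl p u t = (p : ℤ) ^ l * u (t + l) := by
  obtain ⟨l, hl, h⟩ := Finset.exists_mem_eq_inf' (Finset.nonempty_range_iff.2 (NeZero.ne n))
    fun l : ℕ => (p : ℤ) ^ l * u (t + l)
  exact ⟨l, Finset.mem_range.1 hl, h⟩

lemma le_mul_pow (hp : 2 ≤ p) {x : ℤ} (hx : 0 ≤ x) (l : ℕ) : x ≤ (p : ℤ) ^ l * x := by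
  have : (1 : ℤ) ≤ (p : ℤ) ^ l := one_le_pow₀ (by exact_mod_cast (by omega : 1 ≤ p))
  nlinarith

lemma cnt_cl_nonneg (hp : 2 ≤ p) (hu : ∀ t, 0 ≤ u t) (t : ZMod n) : 0 ≤ cnt p (cl p u) t := by
  obtain ⟨l, hl, h⟩ := exists_cl_eq (p := p) u (t + 1)
  have e : (p : ℤ) * cl p u (t + 1) = (p : ℤ) ^ (l + 1) * u (t + ((l + 1 : ℕ) : ZMod n)) := by
    rw [h, show t + 1 + (l : ZMod n) = t + ((l + 1 : ℕ) : ZMod n) by push_cast; ring]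
    ring
  rw [cnt, e, sub_nonneg]
  rcases Nat.lt_or_ge (l + 1) n with h1 | h1
  · exact cl_le_mul u t h1
  · obtain rfl : l + 1 = n := by omega
    rw [ZMod.natCast_self, add_zero]
    exact (cl_le u t).trans (le_mul_pow hp (hu t) _)

lemma cnt_cl_eq_zero_or (hp : 2 ≤ p) (hu : ∀ t, 0 ≤ u t) (t : ZMod n) :
    cnt p (cl p u) t = 0 ∨ cl p u t = u t := by
  obtain ⟨l, hl, h⟩ := exists_cl_eq (p := p) u t
  rcases l with _ | l
  · right
    simpa using h
  · left
    apply le_antisymm _ (cnt_cl_nonneg hp hu t)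
    have := cl_le_mul (p := p) u (t + 1) (show l < n by omega)
    rw [show t + 1 + (l : ZMod n) = t + ((l + 1 : ℕ) : ZMod n) by push_cast; ring] at this
    rw [cnt, h, pow_succ']
    have hp0 : (0 : ℤ) ≤ p := by positivity
    nlinarith

lemma le_cl (hp : 2 ≤ p) {B : ℤ} (hB : 0 ≤ B) (h : ∀ t, B ≤ u t) (t : ZMod n) : B ≤ cl p u t := by
  obtain ⟨l, -, e⟩ := exists_cl_eq (p := p) u t
  rw [e]
  exact (h _).trans (le_mul_pow hp (hB.trans (h _)) l)

lemma cl_add_one_le (hp : 2 ≤ p) (h : ∀ t, u t + 1 ≤ v t) (t : ZMod n) :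
    cl p u t + 1 ≤ cl p v t := by
  obtain ⟨l, hl, e⟩ := exists_cl_eq (p := p) v t
  rw [e]
  have h1 := cl_le_mul (p := p) u t hl
  have h2 : (1 : ℤ) ≤ (p : ℤ) ^ l := one_le_pow₀ (by exact_mod_cast (by omega : 1 ≤ p))
  nlinarith [h (t + l)]

lemma cl_zero : cl p (0 : ZMod n → ℤ) = 0 := by
  funext t
  obtain ⟨l, -, e⟩ := exists_cl_eq (p := p) (0 : ZMod n → ℤ) t
  simpa using e

lemma cl_eq_self (hp : 2 ≤ p) (h : ∀ t, 0 ≤ cnt p u t) : cl p u = u := by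
  funext t
  refine le_antisymm (cl_le u t) ?_
  have key : ∀ l : ℕ, u t ≤ (p : ℤ) ^ l * u (t + l) := by
    intro l
    induction l with
    | zero => simp
    | succ l ih =>
      have := h (t + l)
      rw [cnt, show t + (l : ZMod n) + 1 = t + ((l + 1 : ℕ) : ZMod n) by push_cast; ring] at this
      have h2 : (0 : ℤ) ≤ (p : ℤ) ^ l := by positivity
      rw [pow_succ]
      nlinarith
  obtain ⟨l, -, e⟩ := exists_cl_eq (p := p) u t
  rw [e]
  exact key l

end cl

lemma le_of_cast_eq {n a b : ℕ} (h : (a : ZMod n) = b) (hlt : a < b + n) : a ≤ b := by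
  by_contra hab
  have h1 := (ZMod.natCast_eq_natCast_iff _ _ _).1 h
  have h2 := (Nat.modEq_iff_dvd' (by omega)).1 h1.symm
  have := Nat.le_of_dvd (by omega) h2
  omega

/-- A strictly increasing family `0 = m 0 < ⋯ < m e` whose counts are bounded by `c`. -/
structure Fam (p : ℕ) {n : ℕ} (c : ZMod n → ℤ) (e : ℕ) (m : ℕ → ZMod n → ℤ) : Prop where
  zero : m 0 = 0
  step : ∀ a < e, ∀ t, m a t + 1 ≤ m (a + 1) t
  nonneg : ∀ a ≤ e, ∀ t, 0 ≤ cnt p (m a) t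
  le : ∀ a ≤ e, ∀ t, cnt p (m a) t ≤ c t

/-- Vectors `v ≥ e` whose counts are bounded by `c`. -/
def Feas (p : ℕ) {n : ℕ} (c : ZMod n → ℤ) (e : ℕ) (v : ZMod n → ℤ) : Prop :=
  ∀ t, 0 ≤ cnt p v t ∧ cnt p v t ≤ c t ∧ (e : ℤ) ≤ v t

lemma Fam.add_le {p n : ℕ} {c : ZMod n → ℤ} {e : ℕ} {m : ℕ → ZMod n → ℤ} (h : Fam p c e m)
    (t : ZMod n) {a : ℕ} : ∀ {b : ℕ}, a ≤ b → b ≤ e → m a t + (b - a : ℤ) ≤ m b t := by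
  intro b hab
  induction b, hab using Nat.le_induction with
  | base => intro _; simp
  | succ b hab ih =>
    intro hb
    have h1 := ih (by omega)
    have h2 := h.step b (by omega) t
    push_cast
    linarith

lemma Fam.le_apply {p n : ℕ} {c : ZMod n → ℤ} {e : ℕ} {m : ℕ → ZMod n → ℤ} (h : Fam p c e m)
    (t : ZMod n) {b : ℕ} (hb : b ≤ e) : (b : ℤ) ≤ m b t := by
  have := h.add_le t (Nat.zero_le b) hb
  simpa [h.zero] using this

lemma Fam.feas_top {p n : ℕ} {c : ZMod n → ℤ} {e : ℕ} {m : ℕ → ZMod n → ℤ} (h : Fam p c e m) :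
    Feas p c e (m e) :=
  fun t => ⟨h.nonneg e le_rfl t, h.le e le_rfl t, h.le_apply t le_rfl⟩

section floor

variable {p n : ℕ} [NeZero n]

lemma cnt_floor_le (hp : 2 ≤ p) (c : ZMod n → ℤ) (t : ZMod n) :
    cnt p (fun t => lam p c t / ((p : ℤ) ^ n - 1)) t ≤ c t := by
  have h2 : (2 : ℤ) ≤ p := by exact_mod_cast hp
  have hQ : (0 : ℤ) < (p : ℤ) ^ n - 1 := by
    have := one_lt_pow₀ (by linarith : (1 : ℤ) < p) (NeZero.ne n)
    linarith
  rw [cnt]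
  have h := lam_succ (p := p) c t
  have e1 := Int.mul_ediv_add_emod (lam p c t) ((p : ℤ) ^ n - 1)
  have e2 := Int.mul_ediv_add_emod (lam p c (t + 1)) ((p : ℤ) ^ n - 1)
  have l1 := Int.emod_lt_of_pos (lam p c t) hQ
  have l2 := Int.emod_nonneg (lam p c (t + 1)) hQ.ne'
  set Q := (p : ℤ) ^ n - 1
  set x := lam p c t / Q
  set y := lam p c (t + 1) / Q
  by_contra hc
  push Not at hc
  have : Q * (p * y - x - c t) < Q * 1 := by nlinarith
  have := lt_of_mul_lt_mul_left this hQ.le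
  linarith

lemma le_floor (hp : 2 ≤ p) {c w : ZMod n → ℤ} (h : ∀ t, cnt p w t ≤ c t) (t : ZMod n) :
    w t ≤ lam p c t / ((p : ℤ) ^ n - 1) := by
  have h2 : (2 : ℤ) ≤ p := by exact_mod_cast hp
  have hQ : (0 : ℤ) < (p : ℤ) ^ n - 1 := by
    have := one_lt_pow₀ (by linarith : (1 : ℤ) < p) (NeZero.ne n)
    linarith
  rw [Int.le_ediv_iff_mul_le hQ]
  have := lam_mono (p := p) h t
  rw [lam_cnt] at this
  linarith

lemma le_floor_add_one (hp : 2 ≤ p) {c w : ZMod n → ℤ} {s : ZMod n} (hs : cnt p w s ≤ c s + 1)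
    (h : ∀ t, t ≠ s → cnt p w t ≤ c t) (t : ZMod n) :
    w t ≤ lam p c t / ((p : ℤ) ^ n - 1) + 1 := by
  have h2 : (2 : ℤ) ≤ p := by exact_mod_cast hp
  have hQ : (0 : ℤ) < (p : ℤ) ^ n - 1 := by
    have := one_lt_pow₀ (by linarith : (1 : ℤ) < p) (NeZero.ne n)
    linarith
  rw [← sub_le_iff_le_add, Int.le_ediv_iff_mul_le hQ]
  have h4 : ∑ t', (p : ℤ) ^ (t' - t).val * cnt p w t' ≤
      ∑ t', (p : ℤ) ^ (t' - t).val * (c t' + if t' = s then 1 else 0) := by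
    refine Finset.sum_le_sum fun t' _ => mul_le_mul_of_nonneg_left ?_ (by positivity)
    split_ifs with h5
    · rw [h5]; exact hs
    · rw [add_zero]; exact h _ h5
  simp only [mul_add, Finset.sum_add_distrib, ← lam_eq_sum, mul_ite, mul_one, mul_zero,
    Finset.sum_ite_eq', Finset.mem_univ, if_true, lam_cnt] at h4
  have h5 : (p : ℤ) ^ (s - t).val ≤ (p : ℤ) ^ n - 1 := by
    have := pow_lt_pow_right₀ (by linarith : (1 : ℤ) < p) (ZMod.val_lt (s - t))
    linarith
  linarith

lemma lam_lt_of_floor_lt (hp : 2 ≤ p) {c w : ZMod n → ℤ} {t : ZMod n}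
    (h : lam p c t / ((p : ℤ) ^ n - 1) < w t) : lam p c t < lam p (cnt p w) t := by
  have h2 : (2 : ℤ) ≤ p := by exact_mod_cast hp
  have hQ : (0 : ℤ) < (p : ℤ) ^ n - 1 := by
    have := one_lt_pow₀ (by linarith : (1 : ℤ) < p) (NeZero.ne n)
    linarith
  rw [lam_cnt, mul_comm]
  exact (Int.ediv_lt_iff_lt_mul hQ).1 h

lemma cnt_floor_le_of_floor_lt (hp : 2 ≤ p) {c w : ZMod n → ℤ} {t : ZMod n}
    (h : lam p c t / ((p : ℤ) ^ n - 1) < w t) (hc : cnt p w t ≤ c t)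
    (hle : ∀ t, w t ≤ lam p c t / ((p : ℤ) ^ n - 1) + 1) (hc' : c t ≤ cnt p w t) :
    cnt p (fun t => lam p c t / ((p : ℤ) ^ n - 1)) t < cnt p w t := by
  have h2 : (2 : ℤ) ≤ p := by exact_mod_cast hp
  have hQ : (0 : ℤ) < (p : ℤ) ^ n - 1 := by
    have := one_lt_pow₀ (by linarith : (1 : ℤ) < p) (NeZero.ne n)
    linarith
  have h1 := lam_lt_of_floor_lt hp h
  have h3 := lam_succ (p := p) c t
  have h4 := lam_succ (p := p) (cnt p w) t
  have h5 : lam p c (t + 1) < lam p (cnt p w) (t + 1) := by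
    have : cnt p w t = c t := le_antisymm hc hc'
    rw [this] at h4
    nlinarith
  have h6 : lam p c (t + 1) / ((p : ℤ) ^ n - 1) < w (t + 1) := by
    rw [lam_cnt, mul_comm] at h5
    exact (Int.ediv_lt_iff_lt_mul hQ).2 h5
  have h7 := hle t
  simp only [cnt]
  nlinarith

end floor

/-- Lower each member of a family below the corresponding translate of `f`. -/
def clip (p : ℕ) {n : ℕ} [NeZero n] (e : ℕ) (m : ℕ → ZMod n → ℤ) (f : ZMod n → ℤ) (a : ℕ) :
    ZMod n → ℤ :=
  cl p (if a = e then f else fun t => min (m a t) (f t - (e - a : ℤ)))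

section clip

variable {p n : ℕ} [NeZero n] {c : ZMod n → ℤ} {e : ℕ} {m : ℕ → ZMod n → ℤ} {f : ZMod n → ℤ}

lemma clip_arg_nonneg {p n : ℕ} {c : ZMod n → ℤ} {e : ℕ} {m : ℕ → ZMod n → ℤ} {f : ZMod n → ℤ}
    (h : Fam p c e m) (hf : ∀ t, (e : ℤ) ≤ f t) {a : ℕ} (ha : a ≤ e)
    (t : ZMod n) : 0 ≤ (if a = e then f else fun t => min (m a t) (f t - (e - a : ℤ))) t := by
  have h1 := hf t
  have h2 := h.le_apply t ha
  split_ifs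
  · omega
  · refine le_min ?_ ?_ <;> omega

lemma clip_zero (h : Fam p c e m) (he : 0 < e) (hf : ∀ t, (e : ℤ) ≤ f t) : clip p e m f 0 = 0 := by
  rw [clip, if_neg he.ne, ← cl_zero (p := p)]
  congr 1
  funext t
  have := hf t
  simp [h.zero, this]

lemma clip_step (hp : 2 ≤ p) (h : Fam p c e m) {a : ℕ} (ha : a < e) (t : ZMod n) :
    clip p e m f a t + 1 ≤ clip p e m f (a + 1) t := by
  apply cl_add_one_le hp
  intro t
  rw [if_neg ha.ne]
  have := h.step a ha t
  split_ifs with h1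
  · subst h1; push_cast; omega
  · push_cast; omega

lemma cnt_clip_nonneg (hp : 2 ≤ p) (h : Fam p c e m) (hf : ∀ t, (e : ℤ) ≤ f t) {a : ℕ}
    (ha : a ≤ e) (t : ZMod n) : 0 ≤ cnt p (clip p e m f a) t :=
  cnt_cl_nonneg hp (clip_arg_nonneg h hf ha) t

lemma cnt_clip_top (hp : 2 ≤ p) (h : Fam p c e m) (hf : ∀ t, (e : ℤ) ≤ f t) (t : ZMod n) :
    cnt p (clip p e m f e) t ≤ max 0 (cnt p f t) := by
  have := clip_arg_nonneg h hf le_rfl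
  simp only [if_true] at this
  rw [clip, if_pos rfl]
  rcases cnt_cl_eq_zero_or hp this t with h0 | h0
  · rw [h0]; exact le_max_left _ _
  · apply le_max_of_le_right
    rw [cnt, cnt, h0]
    have h1 := cl_le (p := p) f (t + 1)
    have : (0 : ℤ) ≤ p := by positivity
    nlinarith

lemma cnt_clip (hp : 2 ≤ p) (h : Fam p c e m) (hf : ∀ t, (e : ℤ) ≤ f t)
    (hm : ∀ t, m e t ≤ f t + 1) {a : ℕ} (ha : a < e) (t : ZMod n) :
    cnt p (clip p e m f a) t ≤ cnt p (m a) t ∨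
      (cnt p (clip p e m f a) t = cnt p (m a) t + 1 ∧ m e t = f t + 1 ∧
        cnt p (m a) t + 1 + (p - 1) * (e - a : ℤ) ≤ cnt p f t) := by
  have h0 := clip_arg_nonneg h hf ha.le
  have hm0 := h.nonneg a ha.le t
  simp only [if_neg ha.ne] at h0
  rw [clip, if_neg ha.ne]
  rcases cnt_cl_eq_zero_or hp h0 t with h1 | h1
  · left; rw [h1]; exact hm0
  have h2 := cl_le (p := p) (fun t => min (m a t) (f t - (e - a : ℤ))) (t + 1)
  have hp0 : (2 : ℤ) ≤ p := by exact_mod_cast hp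
  have h3 : cl p (fun t => min (m a t) (f t - (e - a : ℤ))) (t + 1) ≤ m a (t + 1) :=
    h2.trans (min_le_left _ _)
  have h4 : cl p (fun t => min (m a t) (f t - (e - a : ℤ))) (t + 1) ≤ f (t + 1) - (e - a : ℤ) :=
    h2.trans (min_le_right _ _)
  set v := cl p (fun t => min (m a t) (f t - (e - a : ℤ)))
  have h5 := h.add_le t ha.le le_rfl
  have h6 := hm t
  have h7 : (p : ℤ) * v (t + 1) ≤ p * m a (t + 1) := mul_le_mul_of_nonneg_left h3 (by linarith)
  have h8 : (p : ℤ) * v (t + 1) ≤ p * (f (t + 1) - (e - a : ℤ)) :=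
    mul_le_mul_of_nonneg_left h4 (by linarith)
  simp only [cnt] at *
  rcases le_total (m a t) (f t - (e - a : ℤ)) with h9 | h9
  · left
    rw [min_eq_left h9] at h1
    linarith
  · rw [min_eq_right h9] at h1
    by_cases h10 : m a t = f t - (e - a : ℤ)
    · left; linarith
    have h11 : m a t = f t - (e - a : ℤ) + 1 := by omega
    by_cases h12 : p * v (t + 1) - v t ≤ p * m a (t + 1) - m a t
    · left; exact h12
    · right
      refine ⟨?_, by omega, ?_⟩
      · omega
      · nlinarith

end clip

namespace Ranking

variable {p n : ℕ} [NeZero n] (R : Ranking p n)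

/-- The total weight of the counts of `w`. -/
def cost (w : ZMod n → ℤ) : ℕ := R.V fun t => (cnt p w t).toNat

lemma V_add_sdiff {a b : ZMod n → ℕ} (h : ∀ t, a t ≤ b t) :
    R.V b = R.V a + ∑ x ∈ tok b \ tok a, p ^ R.pos x.1 x.2 := by
  rw [V, V, add_comm, Finset.sum_sdiff]
  intro x hx
  rw [mem_tok] at *
  exact hx.trans_le (h _)

/-- Tokens below `k` in classes `t` with few of them: their total weight is noticeably less than
`p ^ k`. -/
lemma pow_mul_sum_sdiff_le {k : ℕ} {s j : ZMod n} (hk : (k : ZMod n) = s) {a b : ZMod n → ℕ}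
    (hpos : ∀ t ρ, a t ≤ ρ → ρ < b t → R.pos t ρ < k)
    (hlt : ∑ t, p ^ (t - j).val * (b t - a t) < p ^ (s - j).val) (hp : 2 ≤ p) :
    p ^ (s - j).val * ∑ x ∈ tok b \ tok a, p ^ R.pos x.1 x.2 ≤
      p ^ k * (p ^ (s - j).val - 1) := by
  have h1 : ∀ x ∈ tok b \ tok a, p ^ (s - j).val * p ^ R.pos x.1 x.2 ≤
      p ^ k * p ^ (x.1 - j).val := by
    rintro ⟨t, ρ⟩ hx
    simp only [Finset.mem_sdiff, mem_tok, not_lt] at hx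
    have h2 := hpos t ρ hx.2 hx.1
    rw [← pow_add, ← pow_add]
    apply Nat.pow_le_pow_right (by omega)
    have hl : (t - j).val < (s - j).val := by
      by_contra hge
      have h3 : p ^ (t - j).val * (b t - a t) ≤ ∑ t, p ^ (t - j).val * (b t - a t) :=
        Finset.single_le_sum (f := fun t => p ^ (t - j).val * (b t - a t))
          (fun _ _ => Nat.zero_le _) (Finset.mem_univ t)
      have h4 : p ^ (s - j).val ≤ p ^ (t - j).val :=
        Nat.pow_le_pow_right (by omega) (not_lt.1 hge)
      have h5 : 1 ≤ b t - a t := by omega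
      have := Nat.mul_le_mul h4 h5
      omega
    have h6 := ZMod.val_lt (s - j)
    apply le_of_cast_eq (n := n)
    · push_cast
      rw [ZMod.natCast_zmod_val, ZMod.natCast_zmod_val, R.cast_pos, hk]
      ring
    · simp only
      omega
  rw [Finset.mul_sum]
  refine (Finset.sum_le_sum h1).trans ?_
  rw [← Finset.mul_sum]
  apply Nat.mul_le_mul_left
  have h2 : ∑ x ∈ tok b \ tok a, p ^ (x.1 - j).val ≤ ∑ t, p ^ (t - j).val * (b t - a t) := by
    have : tok b \ tok a = Finset.univ.sigma fun t => Finset.Ico (a t) (b t) := by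
      ext x
      simp only [Finset.mem_sdiff, mem_tok, not_lt, Finset.mem_sigma, Finset.mem_univ, true_and,
        Finset.mem_Ico]
      omega
    rw [this, Finset.sum_sigma]
    apply le_of_eq
    refine Finset.sum_congr rfl fun t _ => ?_
    simp [mul_comm]
  omega

end Ranking

lemma pow_mul_sum_items_lt {p n : ℕ} [NeZero n] (hp : 2 ≤ p) {k l e : ℕ} (hl : l < n)
    (I : Finset (ℕ × ZMod n))
    (κ : ℕ × ZMod n → ℕ) (hI : ∀ x ∈ I, x.1 < e ∧ (κ x : ZMod n) = x.2 ∧ κ x + n * (e - x.1) ≤ k) :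
    p ^ l * ∑ x ∈ I, p ^ κ x < p ^ k := by
  have hn := NeZero.pos n
  let φ : ℕ × ZMod n → ℕ := fun x => κ x + n * ((k - κ x) / n - (e - x.1))
  have h1 : ∀ x ∈ I, φ x + n * (e - x.1) ≤ k ∧ k < φ x + n * (e - x.1) + n := by
    intro x hx
    obtain ⟨h1, h2, h3⟩ := hI x hx
    have h4 : e - x.1 ≤ (k - κ x) / n := by
      rw [Nat.le_div_iff_mul_le hn, mul_comm]; omega
    have h5 : φ x + n * (e - x.1) = κ x + n * ((k - κ x) / n) := by
      simp only [φ]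
      rw [add_assoc, ← mul_add, Nat.sub_add_cancel h4]
    have h6 := Nat.div_add_mod (k - κ x) n
    have h7 := Nat.mod_lt (k - κ x) hn
    omega
  have h2 : ∀ x ∈ I, (φ x : ZMod n) = x.2 := by
    intro x hx
    simp only [φ]
    push_cast
    simp [(hI x hx).2.1]
  have hinj : Set.InjOn (fun x => φ x + l) I := by
    rintro ⟨a, t⟩ hx ⟨b, u⟩ hy hxy
    simp only [add_left_inj] at hxy
    have e1 := h2 _ hx
    have e2 := h2 _ hy
    rw [hxy, e2] at e1
    simp only at e1
    subst e1
    have e3 := h1 _ hx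
    have e4 := h1 _ hy
    have e5 := (hI _ hx).1
    have e6 := (hI _ hy).1
    rw [hxy] at e3
    simp only at e3 e4 e5 e6
    have : e - a = e - b := by
      rcases lt_trichotomy (e - a) (e - b) with h | h | h
      · have := Nat.mul_le_mul_left n (show e - a + 1 ≤ e - b from h)
        rw [mul_add] at this
        omega
      · exact h
      · have := Nat.mul_le_mul_left n (show e - b + 1 ≤ e - a from h)
        rw [mul_add] at this
        omega
    have : a = b := by omega
    rw [this]
  calc p ^ l * ∑ x ∈ I, p ^ κ x ≤ ∑ x ∈ I, p ^ (φ x + l) := by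
        rw [Finset.mul_sum]
        refine Finset.sum_le_sum fun x _ => ?_
        rw [← pow_add]
        apply Nat.pow_le_pow_right (by omega)
        simp only [φ]
        omega
    _ = ∑ y ∈ I.image fun x => φ x + l, p ^ y := (Finset.sum_image hinj).symm
    _ < p ^ k := by
        apply Nat.geomSum_lt hp
        intro y hy
        obtain ⟨x, hx, rfl⟩ := Finset.mem_image.1 hy
        have e1 := (h1 x hx).1
        have e2 := (hI x hx).1
        have := Nat.le_mul_of_pos_right n (show 0 < e - x.1 by omega)
        omega

namespace Ranking

variable {p n : ℕ} [NeZero n] (R : Ranking p n)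

lemma V_le_add {a b : ZMod n → ℕ} (h : ∀ t, b t ≤ a t + 1) :
    R.V b ≤ R.V a + ∑ t with a t < b t, p ^ R.pos t (a t) := by
  rw [V_eq_sum, V_eq_sum, Finset.sum_filter, ← Finset.sum_add_distrib]
  refine Finset.sum_le_sum fun t _ => ?_
  split_ifs with h1
  · rw [show b t = a t + 1 by have := h t; omega, Finset.sum_range_succ]
  · rw [add_zero]
    exact Finset.sum_le_sum_of_subset (Finset.range_mono (not_lt.1 h1))

lemma V_eq_update_add {r : ZMod n → ℕ} {s : ZMod n} (h : 0 < r s) :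
    R.V r = R.V (Function.update r s (r s - 1)) + p ^ R.pos s (r s - 1) := by
  rw [V_eq_sum, V_eq_sum, ← Finset.add_sum_erase _ _ (Finset.mem_univ s),
    ← Finset.add_sum_erase (a := s) (s := Finset.univ)
      (f := fun t => ∑ ρ ∈ Finset.range (Function.update r s (r s - 1) t), p ^ R.pos t ρ)
      (h := Finset.mem_univ s), add_right_comm]
  congr 1
  · rw [Function.update_self, ← Finset.sum_range_succ (fun ρ => p ^ R.pos s ρ),
      Nat.sub_add_cancel h]
  · refine Finset.sum_congr rfl fun t ht => ?_
    rw [Function.update_of_ne (Finset.ne_of_mem_erase ht)]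

theorem exists_total_lt (hp : 2 ≤ p) {c : ZMod n → ℤ} {e : ℕ} {m : ℕ → ZMod n → ℤ}
    {g : ZMod n → ℤ} (he : 0 < e) (hm : Fam p c e m) (hg : Feas p c e g)
    (hmin : ∀ v, Feas p c e v → R.cost g ≤ R.cost v) (hlt : R.cost g < R.cost (m e)) :
    ∃ m', Fam p c e m' ∧
      ∑ a ∈ Finset.range (e + 1), R.cost (m' a) < ∑ a ∈ Finset.range (e + 1), R.cost (m a) := by
  obtain ⟨s, hs, hD⟩ := R.exists_top_diff hp hlt
  have hp0 : (2 : ℤ) ≤ p := by exact_mod_cast hp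
  set k := R.pos s ((cnt p (m e) s).toNat - 1) with hk
  choose U hU using fun t => R.exists_threshold t k
  set G : ZMod n → ℕ := fun t => (cnt p g t).toNat with hGdef
  set r : ZMod n → ℕ := fun t => (cnt p (m e) t).toNat with hrdef
  replace hs : G s < r s := hs
  replace hD : ∀ t, t ≠ s → ∀ ρ, min (G t) (r t) ≤ ρ → ρ < max (G t) (r t) → R.pos t ρ < k := hD
  have hG : ∀ t, (G t : ℤ) = cnt p g t := fun t => Int.toNat_of_nonneg (hg t).1
  have hr : ∀ t, (r t : ℤ) = cnt p (m e) t := fun t => Int.toNat_of_nonneg (hm.nonneg e le_rfl t)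
  have hrc : ∀ t, (r t : ℤ) ≤ c t := fun t => by rw [hr]; exact hm.le e le_rfl t
  have hGc : ∀ t, (G t : ℤ) ≤ c t := fun t => by rw [hG]; exact (hg t).2.1
  set C : ZMod n → ℕ := fun t => if t = s then r s - 1 else max (r t) (min (U t) (c t).toNat)
    with hCdef
  have hCs : C s = r s - 1 := by simp [hCdef]
  have hCt : ∀ t, t ≠ s → C t = max (r t) (min (U t) (c t).toNat) := fun t ht => by
    simp [hCdef, ht]
  have hGC : ∀ t, G t ≤ C t := by
    intro t
    by_cases ht : t = s
    · subst ht; rw [hCs]; omega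
    · rw [hCt t ht]
      by_contra hgt
      have h1 := hGc t
      have h2 := (hU t (G t - 1)).1 (hD t ht (G t - 1) (by omega) (by omega))
      omega
  have hCc : ∀ t, (C t : ℤ) ≤ c t := by
    intro t
    have h1 := hrc t
    by_cases ht : t = s
    · subst ht; rw [hCs]; omega
    · rw [hCt t ht]; omega
  set f : ZMod n → ℤ := fun t => lam p (fun t => (C t : ℤ)) t / ((p : ℤ) ^ n - 1) with hfdef
  have hf : ∀ t, (e : ℤ) ≤ f t := fun t => (hg t).2.2.trans
    (le_floor hp (fun t => by rw [← hG]; exact_mod_cast hGC t) t)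
  have hrC : ∀ t, t ≠ s → r t ≤ C t := fun t ht => by rw [hCt t ht]; exact le_max_left _ _
  have hM : ∀ t, m e t ≤ f t + 1 := by
    apply le_floor_add_one hp (s := s)
    · rw [← hr, hCs]; omega
    · intro t ht
      rw [← hr]; exact_mod_cast hrC t ht
  have hfC : ∀ t, cnt p f t ≤ C t := fun t => cnt_floor_le hp _ t
  have hztop := cnt_clip_top hp hm hf
  have hz : Feas p c e (clip p e m f e) := by
    intro t
    refine ⟨cnt_clip_nonneg hp hm hf le_rfl t, (hztop t).trans (max_le ?_ ?_), ?_⟩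
    · exact (Int.natCast_nonneg _).trans (hCc t)
    · exact (hfC t).trans (hCc t)
    · rw [clip, if_pos rfl]
      exact le_cl hp (by positivity) hf t
  have hgood : ∀ t, m e t = f t + 1 → t ≠ s → C t ≤ U t := by
    intro t ht hts
    by_contra hCU
    have hCr : C t = r t := by rw [hCt t hts] at hCU ⊢; omega
    have h1 : cnt p f t < cnt p (m e) t := by
      apply cnt_floor_le_of_floor_lt hp _ _ hM
      · rw [← hr, hCr]
      · change f t < _; omega
      · rw [← hr, hCr]
    rw [← hr] at h1
    have hGr : G t = r t := by
      rcases lt_trichotomy (G t) (r t) with h2 | h2 | h2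
      · have := (hU t (r t - 1)).1 (hD t hts _ (by omega) (by omega))
        omega
      · exact h2
      · have := (hU t (r t)).1 (hD t hts _ (by omega) (by omega))
        omega
    refine absurd (hmin _ hz) (not_le.2 (R.V_lt hp (k + 1) ⟨t, r t - 1, ?_, ?_, ?_⟩ ?_))
    · have := hztop t; omega
    · change r t - 1 < G t
      omega
    · have h2 : k ≤ R.pos t (r t - 1) := by
        by_contra hlt
        have := (hU t (r t - 1)).1 (not_le.1 hlt)
        omega
      have h3 := R.pos_ne hts (r t - 1) (r s - 1)
      change k + 1 ≤ _
      have : R.pos s (r s - 1) = k := rfl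
      omega
    · intro u ρ h2 h3
      change G u ≤ ρ at h2
      have h4 : ρ < C u := by
        have h5 := hztop u
        have h6 := hfC u
        omega
      rw [Nat.lt_succ_iff]
      by_cases hu : u = s
      · subst hu
        apply R.mono
        rw [hCs] at h4
        exact h4.le
      · rw [hCt u hu] at h4
        by_cases h5 : ρ < U u
        · exact ((hU u ρ).2 h5).le
        · exact (hD u hu ρ ((min_le_left _ _).trans h2) (lt_max_of_lt_right (by omega))).le
  have hitem : ∀ a < e, ∀ t, cnt p (clip p e m f a) t ≤ cnt p (m a) t ∨
      (cnt p (clip p e m f a) t = cnt p (m a) t + 1 ∧ m e t = f t + 1 ∧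
        cnt p (m a) t + 1 ≤ C t ∧ R.pos t (cnt p (m a) t).toNat + n * (e - a) ≤ k) := by
    intro a ha t
    rcases cnt_clip hp hm hf hM ha t with h1 | ⟨h1, h2, h3⟩
    · exact Or.inl h1
    right
    have h0 := hm.nonneg a ha.le t
    have h4 := hfC t
    have h5 : (cnt p (m a) t).toNat + (p - 1) * (e - a) + 1 ≤ C t := by
      zify [ha.le, show 1 ≤ p by omega]
      rw [Int.toNat_of_nonneg h0]
      linarith
    refine ⟨h1, h2, by omega, (R.pos_add_mul_le t _ _).trans ?_⟩
    by_cases hts : t = s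
    · subst hts
      apply R.mono
      change _ ≤ r t - 1
      omega
    · exact ((hU t _).2 (by have := hgood t h2 hts; omega)).le
  refine ⟨clip p e m f, ⟨clip_zero hm he hf, fun a ha t => clip_step hp hm ha t,
    fun a ha t => cnt_clip_nonneg hp hm hf ha t, ?_⟩, ?_⟩
  · intro a ha t
    rcases ha.lt_or_eq with ha | rfl
    · rcases hitem a ha t with h1 | ⟨h1, -, h2, -⟩
      · exact h1.trans (hm.le a ha.le t)
      · rw [h1]; exact h2.trans (hCc t)
    · exact (hz t).2.1
  set I : Finset (ℕ × ZMod n) := (Finset.range e ×ˢ Finset.univ).filter fun x =>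
    (cnt p (m x.1) x.2).toNat < (cnt p (clip p e m f x.1) x.2).toNat with hI
  set L := ∑ x ∈ I, p ^ R.pos x.2 (cnt p (m x.1) x.2).toNat with hL
  have h1 : ∑ a ∈ Finset.range e, R.cost (clip p e m f a) ≤
      ∑ a ∈ Finset.range e, R.cost (m a) + L := by
    rw [hL, hI, Finset.sum_filter, Finset.sum_product, ← Finset.sum_add_distrib]
    refine Finset.sum_le_sum fun a ha => ?_
    rw [← Finset.sum_filter]
    apply R.V_le_add
    intro t
    have := hm.nonneg a (Finset.mem_range.1 ha).le t
    rcases hitem a (Finset.mem_range.1 ha) t with h1 | ⟨h1, -⟩ <;> omega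
  have hrs : 0 < r s := by omega
  set r0 := Function.update r s (r s - 1) with hr0
  have hr0C : ∀ t, r0 t ≤ C t := by
    intro t
    by_cases ht : t = s
    · subst ht; simp [hr0, hCs]
    · rw [hr0, Function.update_of_ne ht]; exact hrC t ht
  set β := ∑ x ∈ tok C \ tok r0, p ^ R.pos x.1 x.2 with hβ
  have h2 : R.cost (m e) = R.V r0 + p ^ k := R.V_eq_update_add hrs
  have h3 : R.V C = R.V r0 + β := R.V_add_sdiff hr0C
  have h4 : R.cost (clip p e m f e) ≤ R.V C := by
    apply R.V_mono
    intro t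
    have := hztop t
    have := hfC t
    omega
  have hpos : ∀ t ρ, r0 t ≤ ρ → ρ < C t → R.pos t ρ < k := by
    intro t ρ ha hb
    by_cases ht : t = s
    · subst ht; simp only [hr0, Function.update_self] at ha; omega
    · rw [hr0, Function.update_of_ne ht] at ha
      rw [hCt t ht] at hb
      exact (hU t ρ).2 (by omega)
  have hLβ : L + β < p ^ k := by
    rcases I.eq_empty_or_nonempty with h0 | ⟨⟨a, j⟩, h0⟩
    · rw [hL, h0, Finset.sum_empty, zero_add]
      apply R.sum_lt_pow hp
      rintro ⟨t, ρ⟩ hx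
      simp only [Finset.mem_sdiff, mem_tok, not_lt] at hx
      exact hpos t ρ hx.2 hx.1
    · have hI' : ∀ x ∈ I, x.1 < e ∧ m e x.2 = f x.2 + 1 ∧
          R.pos x.2 (cnt p (m x.1) x.2).toNat + n * (e - x.1) ≤ k := by
        intro x hx
        simp only [hI, Finset.mem_filter, Finset.mem_product, Finset.mem_range,
          Finset.mem_univ, and_true] at hx
        rcases hitem x.1 hx.1 x.2 with h5 | h5
        · omega
        · exact ⟨hx.1, h5.2.1, h5.2.2.2⟩
      have h5 := lam_lt_of_floor_lt hp (c := fun t => (C t : ℤ)) (w := m e) (t := j) (by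
        have := (hI' _ h0).2.1
        change f j < _
        simp only at this
        omega)
      have h6 : ∑ t, p ^ (t - j).val * (C t - r0 t) < p ^ (s - j).val := by
        zify
        rw [lam_eq_sum, lam_eq_sum] at h5
        have h7 : ∑ t, (p : ℤ) ^ (t - j).val * cnt p (m e) t =
            ∑ t, (p : ℤ) ^ (t - j).val * (r0 t : ℤ) + (p : ℤ) ^ (s - j).val := by
          have h8 : ∀ t, (p : ℤ) ^ (t - j).val * cnt p (m e) t =
              (p : ℤ) ^ (t - j).val * (r0 t : ℤ) +
                if t = s then (p : ℤ) ^ (t - j).val else 0 := by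
            intro t
            rw [← hr]
            split_ifs with ht
            · subst ht
              simp only [hr0, Function.update_self]
              rw [Nat.cast_sub hrs]
              push_cast
              ring
            · rw [hr0, Function.update_of_ne ht, add_zero]
          simp only [h8, Finset.sum_add_distrib, Finset.sum_ite_eq', Finset.mem_univ, if_true]
        have h9 : ∑ t, (p : ℤ) ^ (t - j).val * ((C t - r0 t : ℕ) : ℤ) =
            ∑ t, (p : ℤ) ^ (t - j).val * (C t : ℤ) -
              ∑ t, (p : ℤ) ^ (t - j).val * (r0 t : ℤ) := by
          rw [← Finset.sum_sub_distrib]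
          refine Finset.sum_congr rfl fun t _ => ?_
          rw [Nat.cast_sub (hr0C t)]
          ring
        rw [h9]
        linarith
      have h7 := R.pow_mul_sum_sdiff_le (R.cast_pos s (r s - 1)) hpos h6 hp
      have h8 := pow_mul_sum_items_lt hp (ZMod.val_lt (s - j)) I
        (fun x => R.pos x.2 (cnt p (m x.1) x.2).toNat)
        (fun x hx => ⟨(hI' x hx).1, R.cast_pos _ _, (hI' x hx).2.2⟩)
      change p ^ (s - j).val * β ≤ p ^ k * (p ^ (s - j).val - 1) at h7
      change p ^ (s - j).val * L < p ^ k at h8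
      have h9 : 0 < p ^ (s - j).val := by positivity
      have h10 : p ^ (s - j).val * (L + β) < p ^ (s - j).val * p ^ k := by
        rw [Nat.mul_sub, mul_one] at h7
        have h11 : p ^ k ≤ p ^ k * p ^ (s - j).val := Nat.le_mul_of_pos_right _ h9
        have h12 := mul_comm (p ^ k) (p ^ (s - j).val)
        rw [mul_add]
        omega
      exact lt_of_mul_lt_mul_left h10 (Nat.zero_le _)
  rw [Finset.sum_range_succ, Finset.sum_range_succ]
  omega

end Ranking

lemma cnt_eq_of_le {p n : ℕ} [NeZero n] (hp : 2 ≤ p) {v w : ZMod n → ℤ}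
    (h : ∀ t, cnt p v t ≤ cnt p w t) {t : ZMod n} (ht : w t ≤ v t) (u : ZMod n) :
    cnt p v u = cnt p w u := by
  have hp0 : (2 : ℤ) ≤ p := by exact_mod_cast hp
  have hQ : (0 : ℤ) < (p : ℤ) ^ n - 1 := by
    have := one_lt_pow₀ (by linarith : (1 : ℤ) < p) (NeZero.ne n)
    linarith
  by_contra hne
  have hlt : lam p (cnt p v) t < lam p (cnt p w) t := by
    rw [lam_eq_sum, lam_eq_sum]
    refine Finset.sum_lt_sum (fun x _ => mul_le_mul_of_nonneg_left (h x) (by positivity))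
      ⟨u, Finset.mem_univ _, ?_⟩
    exact mul_lt_mul_of_pos_left (lt_of_le_of_ne (h u) hne) (by positivity)
  rw [lam_cnt, lam_cnt] at hlt
  nlinarith

lemma cnt_injective {p n : ℕ} [NeZero n] (hp : 2 ≤ p) {v w : ZMod n → ℤ}
    (h : ∀ t, cnt p v t = cnt p w t) : v = w := by
  have hp0 : (2 : ℤ) ≤ p := by exact_mod_cast hp
  have hQ : (0 : ℤ) < (p : ℤ) ^ n - 1 := by
    have := one_lt_pow₀ (by linarith : (1 : ℤ) < p) (NeZero.ne n)
    linarith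
  funext t
  have := lam_cnt (p := p) v t
  rw [funext h, lam_cnt] at this
  exact (mul_left_cancel₀ hQ.ne' this).symm

/-- The counts of the members of a family increase. -/
def Nested (p : ℕ) {n : ℕ} (e : ℕ) (m : ℕ → ZMod n → ℤ) : Prop :=
  ∀ a < e, ∀ t, cnt p (m a) t ≤ cnt p (m (a + 1)) t

namespace Ranking

variable {p n : ℕ} [NeZero n] (R : Ranking p n)

/-- The sum of the costs of the members of a family. -/
def total (e : ℕ) (m : ℕ → ZMod n → ℤ) : ℕ := ∑ a ∈ Finset.range (e + 1), R.cost (m a)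

lemma cnt_eq_of_cost_le (hp : 2 ≤ p) {v w : ZMod n → ℤ} (h0 : ∀ t, 0 ≤ cnt p v t)
    (h : ∀ t, cnt p v t ≤ cnt p w t) (hc : R.cost w ≤ R.cost v) (t : ZMod n) :
    cnt p v t = cnt p w t := by
  by_contra hne
  have h1 := h t
  have h2 := h0 t
  refine absurd hc (not_le.2 (R.V_lt hp 0 ⟨t, (cnt p v t).toNat, le_rfl, by omega, by omega⟩ ?_))
  intro u ρ h3 h4
  have := h u
  omega

lemma V_add_V_le {a b a' b' : ZMod n → ℕ}
    (h : ∀ t, ∃ δ, a' t = a t + δ ∧ b t = b' t + δ ∧ (a t + δ ≤ b t ∨ δ = 0)) :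
    R.V a' + R.V b' ≤ R.V a + R.V b := by
  simp only [V_eq_sum, ← Finset.sum_add_distrib]
  refine Finset.sum_le_sum fun t _ => ?_
  obtain ⟨δ, h1, h2, h3⟩ := h t
  rw [h1, h2, Finset.sum_range_add, Finset.sum_range_add, add_assoc]
  have hp : ∀ i ∈ Finset.range δ, p ^ R.pos t (a t + i) ≤ p ^ R.pos t (b' t + i) := by
    intro i hi
    rw [Finset.mem_range] at hi
    rcases Nat.eq_zero_or_pos p with rfl | hp
    · exfalso
      have := R.gap t 0
      have := NeZero.pos n
      simp at *
      omega
    · exact Nat.pow_le_pow_right hp (R.mono t (by omega))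
  have := Finset.sum_le_sum hp
  omega

lemma cost_le_of_total_min (hp : 2 ≤ p) {c : ZMod n → ℤ} {e : ℕ} {m : ℕ → ZMod n → ℤ}
    (hm : Fam p c e m) (hmin : ∀ m', Fam p c e m' → R.total e m ≤ R.total e m')
    {v : ZMod n → ℤ} (hv : Feas p c e v) : R.cost (m e) ≤ R.cost v := by
  rcases Nat.eq_zero_or_pos e with rfl | he
  · rw [hm.zero]
    simp [cost, V_eq_sum, cnt]
  obtain ⟨g, hg, hgmin⟩ := WellFounded.has_min (measure R.cost).wf {v | Feas p c e v} ⟨v, hv⟩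
  replace hgmin : ∀ w, Feas p c e w → R.cost g ≤ R.cost w := fun w hw => not_lt.1 (hgmin w hw)
  refine le_trans ?_ (hgmin v hv)
  by_contra hlt
  obtain ⟨m', h1, h2⟩ := R.exists_total_lt hp he hm hg hgmin (not_le.1 hlt)
  exact absurd (hmin m' h1) (not_le.2 h2)

lemma exists_fam_below (hp : 2 ≤ p) {c : ZMod n → ℤ} {e : ℕ} {m : ℕ → ZMod n → ℤ}
    (hm : Fam p c (e + 1) m) (hmin : ∀ v, Feas p c (e + 1) v → R.cost (m (e + 1)) ≤ R.cost v) :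
    ∃ m', Fam p (cnt p (m (e + 1))) e m' ∧ (∀ t, m' e t + 1 ≤ m (e + 1) t) ∧
      R.total e m' ≤ R.total e m := by
  have hp0 : (2 : ℤ) ≤ p := by exact_mod_cast hp
  set g := m (e + 1) with hg
  have hgn := hm.nonneg (e + 1) le_rfl
  have hgc := hm.le (e + 1) le_rfl
  set D : ℕ → ZMod n → ℤ := fun a => cl p (fun t => g t - m a t) with hD
  have hge : ∀ a ≤ e, ∀ t, (e + 1 - a : ℤ) ≤ g t - m a t := by
    intro a ha t
    have := hm.add_le t (show a ≤ e + 1 by omega) le_rfl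
    push_cast at this
    linarith
  have hDn : ∀ a ≤ e, ∀ t, 0 ≤ cnt p (D a) t := fun a ha t =>
    cnt_cl_nonneg hp (fun t => by have := hge a ha t; omega) t
  have hDl : ∀ a ≤ e, ∀ t, cnt p (D a) t = 0 ∨ cnt p (D a) t ≤ cnt p g t - cnt p (m a) t := by
    intro a ha t
    rcases cnt_cl_eq_zero_or (u := fun t => g t - m a t) hp
      (fun t => by have := hge a ha t; omega) t with h | h
    · exact Or.inl h
    · right
      have h1 := cl_le (p := p) (fun t => g t - m a t) (t + 1)
      simp only [cnt, hD]
      rw [h]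
      nlinarith
  have hDe : ∀ a ≤ e, ∀ t, (e + 1 - a : ℤ) ≤ D a t := fun a ha t =>
    le_cl hp (by omega) (hge a ha) t
  have hsub : ∀ a t, cnt p (fun t => g t - D a t) t = cnt p g t - cnt p (D a) t := by
    intro a t
    simp only [cnt]
    ring
  have hadd : ∀ a t, cnt p (fun t => m a t + D a t) t = cnt p (m a) t + cnt p (D a) t := by
    intro a t
    simp only [cnt]
    ring
  refine ⟨fun a t => g t - D a t, ⟨?_, ?_, ?_, ?_⟩, ?_, ?_⟩
  · have : D 0 = g := by
      simp only [hD, hm.zero, Pi.zero_apply, sub_zero]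
      exact cl_eq_self hp hgn
    funext t
    simp [this]
  · intro a ha t
    have := cl_add_one_le (p := p) (u := fun t => g t - m (a + 1) t) (v := fun t => g t - m a t)
      hp (fun t => by have := hm.step a (by omega) t; linarith) t
    simp only [hD]
    linarith
  · intro a ha t
    rw [hsub]
    have h1 := hm.nonneg a (by omega) t
    have h2 := hgn t
    rcases hDl a ha t with h | h <;> linarith
  · intro a ha t
    rw [hsub]
    linarith [hDn a ha t]
  · intro t
    have := hDe e le_rfl t
    simp only
    linarith
  · refine Finset.sum_le_sum fun a ha => ?_
    have ha : a ≤ e := by rw [Finset.mem_range] at ha; omega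
    have h1 : Feas p c (e + 1) (fun t => m a t + D a t) := by
      intro t
      rw [hadd]
      have h1 := hm.nonneg a (by omega) t
      have h2 := hDn a ha t
      have h3 := hm.le a (by omega) t
      have h4 := hgc t
      have h5 := hm.le_apply t (show a ≤ e + 1 by omega)
      have h6 := hDe a ha t
      refine ⟨by linarith, ?_, by push_cast; linarith⟩
      rcases hDl a ha t with h | h <;> linarith
    have h2 := hmin _ h1
    have h3 : R.cost (fun t => m a t + D a t) + R.cost (fun t => g t - D a t) ≤
        R.cost (m a) + R.cost g := by
      apply R.V_add_V_le
      intro t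
      refine ⟨(cnt p (D a) t).toNat, ?_⟩
      simp only [hsub, hadd]
      have h1 := hm.nonneg a (by omega) t
      have h2 := hDn a ha t
      have h3 := hgn t
      rcases hDl a ha t with h | h <;> omega
    simp only
    omega

theorem exists_nested_total_min (hp : 2 ≤ p) (e : ℕ) : ∀ (c : ZMod n → ℤ)
    (m : ℕ → ZMod n → ℤ), Fam p c e m →
    ∃ x, Fam p c e x ∧ Nested p e x ∧ ∀ m', Fam p c e m' → R.total e x ≤ R.total e m' := by
  induction e with
  | zero =>
    intro c m hm
    refine ⟨m, hm, fun a ha => absurd ha (Nat.not_lt_zero _), fun m' hm' => ?_⟩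
    simp [total, hm.zero, hm'.zero]
  | succ e ih =>
    intro c m hm
    obtain ⟨x, hx, hxmin⟩ := WellFounded.has_min (measure (R.total (e + 1))).wf
      {m | Fam p c (e + 1) m} ⟨m, hm⟩
    replace hx : Fam p c (e + 1) x := hx
    replace hxmin : ∀ w, Fam p c (e + 1) w → R.total (e + 1) x ≤ R.total (e + 1) w :=
      fun w hw => not_lt.1 (hxmin w hw)
    have hgmin := fun v hv => R.cost_le_of_total_min hp hx hxmin (v := v) hv
    obtain ⟨y, hy, hyg, hyt⟩ := R.exists_fam_below hp hx hgmin
    obtain ⟨z, hz, hzn, hzmin⟩ := ih _ y hy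
    set g := x (e + 1) with hg
    have hzg : ∀ t, z e t + 1 ≤ g t := by
      intro t
      by_contra hlt
      have h1 := cnt_eq_of_le hp (hz.le e le_rfl) (t := t) (by omega)
      have h2 := R.cost_le_of_total_min hp hz hzmin hy.feas_top
      have h3 : R.cost (z e) = R.cost g := by rw [cost, cost]; simp only [h1]
      have h4 := R.cnt_eq_of_cost_le hp (hy.nonneg e le_rfl) (hy.le e le_rfl) (h3 ▸ h2)
      have h5 := cnt_injective hp h4
      have := hyg t
      rw [h5] at this
      omega
    have hle : ∀ a ≤ e, (if a ≤ e then z a else g) = z a := fun a ha => if_pos ha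
    have htop : (if e + 1 ≤ e then z (e + 1) else g) = g := if_neg (by omega)
    refine ⟨fun a => if a ≤ e then z a else g, ⟨?_, ?_, ?_, ?_⟩, ?_, ?_⟩
    · simp [hz.zero]
    · intro a ha t
      rcases (Nat.lt_succ_iff.1 ha).lt_or_eq with h | rfl
      · rw [hle a h.le, hle (a + 1) h]
        exact hz.step a h t
      · rw [hle a le_rfl, htop]
        exact hzg t
    · intro a ha t
      rcases ha.lt_or_eq with h | rfl
      · rw [hle a (by omega)]
        exact hz.nonneg a (by omega) t
      · rw [htop]
        exact hx.nonneg _ le_rfl t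
    · intro a ha t
      rcases ha.lt_or_eq with h | rfl
      · rw [hle a (by omega)]
        exact (hz.le a (by omega) t).trans (hx.le _ le_rfl t)
      · rw [htop]
        exact hx.le _ le_rfl t
    · intro a ha t
      rcases (Nat.lt_succ_iff.1 ha).lt_or_eq with h | rfl
      · simp only
        rw [hle a h.le, hle (a + 1) h]
        exact hzn a h t
      · simp only
        rw [hle a le_rfl, htop]
        exact hz.le a le_rfl t
    · intro m' hm'
      refine le_trans ?_ (hxmin m' hm')
      have h3 : R.total (e + 1) x = R.total e x + R.cost g := Finset.sum_range_succ _ _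
      rw [h3, total, Finset.sum_range_succ, htop]
      have h1 := (hzmin y hy).trans hyt
      have h2 : ∑ a ∈ Finset.range (e + 1), R.cost (if a ≤ e then z a else g) = R.total e z :=
        Finset.sum_congr rfl fun a ha => by
          rw [hle a (by rw [Finset.mem_range] at ha; omega)]
      rw [h2]
      exact Nat.add_le_add_right h1 _

theorem cost_le_of_nested_min (hp : 2 ≤ p) {c : ZMod n → ℤ} {e : ℕ} {m : ℕ → ZMod n → ℤ}
    (hm : Fam p c e m)
    (hmin : ∀ m', Fam p c e m' → Nested p e m' → R.total e m ≤ R.total e m')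
    {v : ZMod n → ℤ} (hv : Feas p c e v) : R.cost (m e) ≤ R.cost v := by
  obtain ⟨x, hx, hxn, hxmin⟩ := R.exists_nested_total_min hp e c m hm
  exact R.cost_le_of_total_min hp hm
    (fun m' hm' => (hmin x hx hxn).trans (hxmin m' hm')) hv

end Ranking

/-- The `κ`-th base-`p` digit of `y`. -/
def dig (p y κ : ℕ) : ℕ := y / p ^ κ % p

/-- Digitwise comparison in base `p`. -/
def DigLE (p a b : ℕ) : Prop := ∀ κ, dig p a κ ≤ dig p b κ

section digits

variable {p : ℕ}

lemma dig_lt (hp : 2 ≤ p) (y κ : ℕ) : dig p y κ < p := Nat.mod_lt _ (by omega)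

lemma mod_pow_eq_sum (y K : ℕ) : y % p ^ K = ∑ κ ∈ Finset.range K, dig p y κ * p ^ κ := by
  induction K with
  | zero => simp [Nat.mod_one]
  | succ K ih =>
    rw [Finset.sum_range_succ, ← ih, Nat.mod_pow_succ, dig]
    ring

lemma eq_sum_dig {y N : ℕ} (h : y < p ^ N) : y = ∑ κ ∈ Finset.range N, dig p y κ * p ^ κ := by
  rw [← mod_pow_eq_sum, Nat.mod_eq_of_lt h]

lemma dig_eq_zero {y N κ : ℕ} (hp : 2 ≤ p) (h : y < p ^ N) (hκ : N ≤ κ) : dig p y κ = 0 := by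
  rw [dig, Nat.div_eq_of_lt (h.trans_le (Nat.pow_le_pow_right (by omega) hκ)), Nat.zero_mod]

lemma DigLE.le (hp : 2 ≤ p) {a b : ℕ} (h : DigLE p a b) : a ≤ b := by
  have h1 : a < p ^ (a + b) :=
    (Nat.le_add_right a b).trans_lt (Nat.lt_pow_self (by omega))
  have h2 : b < p ^ (a + b) :=
    (Nat.le_add_left b a).trans_lt (Nat.lt_pow_self (by omega))
  calc a = _ := eq_sum_dig h1
    _ ≤ _ := Finset.sum_le_sum fun κ _ => Nat.mul_le_mul_right _ (h κ)
    _ = b := (eq_sum_dig h2).symm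

lemma DigLE.trans {a b c : ℕ} (h : DigLE p a b) (h' : DigLE p b c) : DigLE p a c :=
  fun κ => (h κ).trans (h' κ)

lemma dig_sum (hp : 2 ≤ p) {D : ℕ → ℕ} (hD : ∀ κ, D κ < p) {N j : ℕ} (hj : j < N) :
    dig p (∑ κ ∈ Finset.range N, D κ * p ^ κ) j = D j := by
  have hlt : ∀ K, ∑ κ ∈ Finset.range K, D κ * p ^ κ < p ^ K := by
    intro K
    induction K with
    | zero => simp
    | succ K ih =>
      rw [Finset.sum_range_succ, pow_succ]
      have := Nat.mul_le_mul_right (p ^ K) (show D K + 1 ≤ p from hD K)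
      rw [add_mul, one_mul] at this
      rw [mul_comm (p ^ K) p]
      omega
  obtain ⟨M, rfl⟩ := Nat.exists_eq_add_of_lt hj
  rw [show j + M + 1 = j + 1 + M by ring, Finset.sum_range_add, Finset.sum_range_succ]
  have h1 : ∑ x ∈ Finset.range M, D (j + 1 + x) * p ^ (j + 1 + x) =
      p ^ j * (p * ∑ x ∈ Finset.range M, D (j + 1 + x) * p ^ x) := by
    rw [Finset.mul_sum, Finset.mul_sum]
    refine Finset.sum_congr rfl fun x _ => ?_
    rw [pow_add, pow_add, pow_one]
    ring
  rw [h1, dig, mul_comm (D j), add_assoc, ← mul_add, Nat.add_mul_div_left _ _ (by positivity),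
    Nat.div_eq_of_lt (hlt j), zero_add, Nat.add_mul_mod_self_left, Nat.mod_eq_of_lt (hD j)]

lemma not_dvd_choose_iff (hp : p.Prime) (b a : ℕ) : ¬ p ∣ b.choose a ↔ DigLE p a b := by
  have := Fact.mk hp
  have h2 := hp.two_le
  set K := a + b with hK
  have ha : a < p ^ K := (Nat.le_add_right a b).trans_lt (Nat.lt_pow_self (by omega))
  have hb : b < p ^ K := (Nat.le_add_left b a).trans_lt (Nat.lt_pow_self (by omega))
  rw [Nat.ModEq.dvd_iff (Choose.choose_modEq_prod_range_choose_nat hb ha) dvd_rfl, hp.prime.dvd_finsetProd_iff]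
  push Not
  constructor
  · intro h3 κ
    by_cases hκ : κ < K
    · by_contra hlt
      exact h3 κ (Finset.mem_range.2 hκ) (by
        change p ∣ (dig p b κ).choose (dig p a κ)
        rw [Nat.choose_eq_zero_of_lt (not_le.1 hlt)]; exact dvd_zero _)
    · rw [dig_eq_zero h2 ha (not_lt.1 hκ)]
      exact Nat.zero_le _
  · intro h3 κ _ h4
    have h5 := (hp.dvd_factorial.1 (h4.trans
      (Dvd.intro (_ * _) (by rw [← mul_assoc]; exact Nat.choose_mul_factorial_mul_factorial (h3 κ)))))
    exact absurd (dig_lt h2 b κ) (not_lt.2 h5)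

end digits

section cum

variable {n : ℕ}

/-- The sum of `I κ` over `κ < K` in the class `t`. -/
def cum (I : ℕ → ℕ) (t : ZMod n) (K : ℕ) : ℕ :=
  ∑ κ ∈ Finset.range K, if (κ : ZMod n) = t then I κ else 0

lemma cum_succ (I : ℕ → ℕ) (t : ZMod n) (K : ℕ) :
    cum I t (K + 1) = cum I t K + if (K : ZMod n) = t then I K else 0 :=
  Finset.sum_range_succ _ _

lemma cum_mono (I : ℕ → ℕ) (t : ZMod n) : Monotone (cum I t) :=
  monotone_nat_of_le_succ fun K => by rw [cum_succ]; exact Nat.le_add_right _ _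

lemma cum_le_cum {I J : ℕ → ℕ} (h : ∀ κ, I κ ≤ J κ) (t : ZMod n) (K : ℕ) :
    cum I t K ≤ cum J t K :=
  Finset.sum_le_sum fun κ _ => by split_ifs <;> simp [h]

lemma sum_mul_cum [NeZero n] {A : Type*} [CommSemiring A] (I : ℕ → ℕ) (g : ZMod n → A) (K : ℕ) :
    ∑ t, g t * (cum I t K : A) = ∑ κ ∈ Finset.range K, g κ * (I κ : A) := by
  simp only [cum, Nat.cast_sum, Finset.mul_sum]
  rw [Finset.sum_comm]
  refine Finset.sum_congr rfl fun κ _ => ?_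
  simp

lemma exists_lt_cum [NeZero n] {I : ℕ → ℕ} {N : ℕ} (hI : ∀ κ, N ≤ κ → 1 ≤ I κ) (t : ZMod n)
    (ρ : ℕ) : ∃ κ, ρ < cum I t (κ + 1) := by
  have key : ∀ K, ∃ κ, cum I t K < cum I t (κ + 1) := by
    intro K
    have hn := NeZero.pos n
    have h1 : max K N ≤ t.val + n * max K N :=
      (Nat.le_mul_of_pos_left _ hn).trans (Nat.le_add_left _ _)
    refine ⟨t.val + n * max K N, ?_⟩
    rw [cum_succ, if_pos (by push_cast; simp)]
    have h2 := cum_mono I t ((le_max_left K N).trans h1)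
    have h3 := hI _ ((le_max_right K N).trans h1)
    omega
  induction ρ with
  | zero =>
    obtain ⟨κ, h⟩ := key 0
    exact ⟨κ, by omega⟩
  | succ ρ ih =>
    obtain ⟨κ, h⟩ := ih
    obtain ⟨κ', h'⟩ := key (κ + 1)
    exact ⟨κ', by omega⟩

lemma cum_find_le [NeZero n] {I : ℕ → ℕ} {N : ℕ} (hI : ∀ κ, N ≤ κ → 1 ≤ I κ) (t : ZMod n)
    (ρ : ℕ) : cum I t (Nat.find (exists_lt_cum hI t ρ)) ≤ ρ := by
  rcases hκ : Nat.find (exists_lt_cum hI t ρ) with _ | κ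
  · simp [cum]
  · exact not_lt.1 (Nat.find_min (exists_lt_cum hI t ρ) (m := κ) (by omega))

lemma cast_find [NeZero n] {I : ℕ → ℕ} {N : ℕ} (hI : ∀ κ, N ≤ κ → 1 ≤ I κ) (t : ZMod n)
    (ρ : ℕ) : ((Nat.find (exists_lt_cum hI t ρ) : ℕ) : ZMod n) = t := by
  have h1 := Nat.find_spec (exists_lt_cum hI t ρ)
  by_contra hne
  rw [cum_succ, if_neg hne, add_zero] at h1
  exact absurd (cum_find_le hI t ρ) (not_le.2 h1)

end cum

/-- The ranking in which the position `κ` occurs `I κ` times. -/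
noncomputable def rankingOf (p n : ℕ) [NeZero n] (I : ℕ → ℕ) (N : ℕ)
    (hI : ∀ κ, I κ ≤ p - 1) (hN : ∀ κ, N ≤ κ → 1 ≤ I κ) : Ranking p n where
  pos t ρ := Nat.find (exists_lt_cum hN t ρ)
  mono t _ σ h := Nat.find_min' _ (h.trans_lt (Nat.find_spec (exists_lt_cum hN t σ)))
  cast_pos := cast_find hN
  gap t ρ := by
    by_contra hlt
    have h1 := le_of_cast_eq ((cast_find hN t (ρ + (p - 1))).trans (cast_find hN t ρ).symm)
      (not_le.1 hlt)
    have h2 := Nat.find_spec (exists_lt_cum hN t (ρ + (p - 1)))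
    have h3 := cum_mono I t (Nat.succ_le_succ h1)
    have h4 := cum_find_le hN t ρ
    have h5 := cum_succ I t (Nat.find (exists_lt_cum hN t ρ))
    rw [if_pos (cast_find hN t ρ)] at h5
    have h6 := hI (Nat.find (exists_lt_cum hN t ρ))
    simp only [Nat.succ_eq_add_one] at h3
    omega

section rankingOf

variable {p n : ℕ} [NeZero n] {I : ℕ → ℕ} {N : ℕ} (hI : ∀ κ, I κ ≤ p - 1)
  (hN : ∀ κ, N ≤ κ → 1 ≤ I κ)

lemma rankingOf_pos_le_iff (t : ZMod n) (ρ κ : ℕ) :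
    (rankingOf p n I N hI hN).pos t ρ ≤ κ ↔ ρ < cum I t (κ + 1) := by
  constructor
  · intro h
    exact (Nat.find_spec (exists_lt_cum hN t ρ)).trans_le (cum_mono I t (Nat.succ_le_succ h))
  · exact fun h => Nat.find_min' _ h

lemma rankingOf_pos_lt_iff (t : ZMod n) (ρ κ : ℕ) :
    (rankingOf p n I N hI hN).pos t ρ < κ ↔ ρ < cum I t κ := by
  rcases κ with _ | κ
  · simp [cum]
  · rw [Nat.lt_succ_iff]
    exact rankingOf_pos_le_iff hI hN t ρ κ

lemma V_cum_le (hp : 2 ≤ p) {J : ℕ → ℕ} (hJ : ∀ κ, J κ ≤ I κ) (K : ℕ) :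
    (rankingOf p n I N hI hN).V (fun t => cum J t K) ≤ ∑ κ ∈ Finset.range K, J κ * p ^ κ := by
  have h1 : ∀ t : ZMod n, ∑ ρ ∈ Finset.range (cum J t K), p ^ (rankingOf p n I N hI hN).pos t ρ ≤
      cum (fun κ => J κ * p ^ κ) t K := by
    intro t
    induction K with
    | zero => simp [cum]
    | succ K ih =>
      have h0 : ∀ x ∈ Finset.range (if (K : ZMod n) = t then J K else 0),
          p ^ (rankingOf p n I N hI hN).pos t (cum J t K + x) ≤ p ^ K := by
        intro x hx
        apply Nat.pow_le_pow_right (by omega)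
        rw [rankingOf_pos_le_iff]
        refine lt_of_lt_of_le ?_ (cum_le_cum hJ t (K + 1))
        rw [cum_succ]
        rw [Finset.mem_range] at hx
        omega
      have h2 := Finset.sum_le_sum h0
      rw [Finset.sum_const, Finset.card_range, smul_eq_mul] at h2
      rw [cum_succ, cum_succ, Finset.sum_range_add]
      refine add_le_add ih (h2.trans ?_)
      split_ifs <;> simp
  rw [Ranking.V_eq_sum]
  refine (Finset.sum_le_sum fun t _ => h1 t).trans (le_of_eq ?_)
  simpa using sum_mul_cum (A := ℕ) (fun κ => J κ * p ^ κ) (fun _ : ZMod n => 1) K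

lemma dig_V (hp : 2 ≤ p) {r : ZMod n → ℕ} (hr : ∀ t, r t ≤ cum I t N) (κ : ℕ) :
    dig p ((rankingOf p n I N hI hN).V r) κ =
      ((Ranking.tok r).filter fun x => (rankingOf p n I N hI hN).pos x.1 x.2 = κ).card := by
  set R := rankingOf p n I N hI hN with hR
  have hpos : ∀ x ∈ Ranking.tok r, R.pos x.1 x.2 < N := by
    intro x hx
    rw [Ranking.mem_tok] at hx
    rw [hR, rankingOf_pos_lt_iff]
    exact hx.trans_le (hr _)
  rcases lt_or_ge κ N with hκ | hκ
  · have : R.V r = ∑ κ ∈ Finset.range N,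
        ((Ranking.tok r).filter fun x => R.pos x.1 x.2 = κ).card * p ^ κ := by
      rw [Ranking.V, ← Finset.sum_fiberwise_of_maps_to (g := fun x => R.pos x.1 x.2)
        (fun x hx => Finset.mem_range.2 (hpos x hx))]
      refine Finset.sum_congr rfl fun κ _ => ?_
      rw [Finset.sum_congr rfl (g := fun _ => p ^ κ)
        (fun x hx => by rw [(Finset.mem_filter.1 hx).2]), Finset.sum_const, smul_eq_mul]
    rw [this]
    apply dig_sum hp (D := fun κ => ((Ranking.tok r).filter fun x => R.pos x.1 x.2 = κ).card) _ hκ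
    intro κ
    have := R.card_fiber_le (Ranking.tok r) κ
    omega
  · have h0 : R.V r < p ^ N := R.sum_lt_pow hp _ N hpos
    rw [dig_eq_zero hp h0 hκ]
    symm
    rw [Finset.card_eq_zero, Finset.filter_eq_empty_iff]
    intro x hx
    have := hpos x hx
    omega

lemma digLE_V (hp : 2 ≤ p) {r r' : ZMod n → ℕ} (h : ∀ t, r t ≤ r' t)
    (hr : ∀ t, r' t ≤ cum I t N) :
    DigLE p ((rankingOf p n I N hI hN).V r) ((rankingOf p n I N hI hN).V r') := by
  intro κ
  rw [dig_V hI hN hp hr, dig_V hI hN hp (fun t => (h t).trans (hr t))]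
  apply Finset.card_le_card
  apply Finset.filter_subset_filter
  intro x hx
  rw [Ranking.mem_tok] at *
  exact hx.trans_le (h _)

lemma dig_V_le (hp : 2 ≤ p) {r : ZMod n → ℕ} (hr : ∀ t, r t ≤ cum I t N) (κ : ℕ) :
    dig p ((rankingOf p n I N hI hN).V r) κ ≤ I κ := by
  rw [dig_V hI hN hp hr]
  set R := rankingOf p n I N hI hN with hR
  have hsub : (Ranking.tok r).filter (fun x => R.pos x.1 x.2 = κ) ⊆
      (Finset.Ico (cum I (κ : ZMod n) κ) (cum I (κ : ZMod n) (κ + 1))).image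
        (fun ρ => (⟨(κ : ZMod n), ρ⟩ : Σ _ : ZMod n, ℕ)) := by
    rintro ⟨t, ρ⟩ hx
    have h := (Finset.mem_filter.1 hx).2
    simp only at h
    have ht : (κ : ZMod n) = t := by rw [← h, R.cast_pos]
    subst ht
    rw [Finset.mem_image]
    refine ⟨ρ, Finset.mem_Ico.2 ⟨?_, ?_⟩, rfl⟩
    · rw [← not_lt, ← rankingOf_pos_lt_iff hI hN, ← hR]; omega
    · rw [← rankingOf_pos_lt_iff hI hN, ← hR]; omega
  refine (Finset.card_le_card hsub).trans (Finset.card_image_le.trans ?_)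
  rw [Nat.card_Ico, cum_succ, if_pos rfl]
  omega

end rankingOf

lemma pow_modEq_of_cast_eq {p n a b : ℕ} [NeZero n] (h : (a : ZMod n) = b) :
    (p : ℤ) ^ a ≡ (p : ℤ) ^ b [ZMOD (p : ℤ) ^ n - 1] := by
  have h1 : (p : ℤ) ^ n ≡ 1 [ZMOD (p : ℤ) ^ n - 1] :=
    (Int.modEq_iff_dvd.2 ⟨-1, by ring⟩)
  have key : ∀ a : ℕ, (p : ℤ) ^ a ≡ (p : ℤ) ^ (a % n) [ZMOD (p : ℤ) ^ n - 1] := by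
    intro a
    conv_lhs => rw [← Nat.mod_add_div a n, pow_add, pow_mul]
    simpa using ((h1.pow (a / n)).mul_left ((p : ℤ) ^ (a % n)))
  have h2 := (ZMod.natCast_eq_natCast_iff' _ _ _).1 h
  exact (key a).trans (h2 ▸ (key b).symm)

lemma Ranking.V_modEq {p n : ℕ} [NeZero n] (R : Ranking p n) (r : ZMod n → ℕ) :
    (R.V r : ℤ) ≡ lam p (fun t => (r t : ℤ)) 0 [ZMOD (p : ℤ) ^ n - 1] := by
  rw [lam_eq_sum, R.V_eq_sum]
  push_cast
  refine Int.ModEq.sum fun t _ => ?_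
  rw [sub_zero, mul_comm, ← nsmul_eq_mul, ← Finset.card_range (r t), ← Finset.sum_const,
    Finset.card_range]
  refine Int.ModEq.sum fun ρ _ => pow_modEq_of_cast_eq ?_
  rw [R.cast_pos, ZMod.natCast_zmod_val]

lemma dvd_lam_cum {p n : ℕ} [NeZero n] {y N : ℕ} (hy : y < p ^ N)
    (h : (p : ℤ) ^ n - 1 ∣ (y : ℤ)) (j : ZMod n) :
    (p : ℤ) ^ n - 1 ∣ lam p (fun t => (cum (dig p y) t N : ℤ)) j := by
  have hs := sum_mul_cum (A := ℤ) (dig p y) (fun t : ZMod n => (p : ℤ) ^ (t - j).val) N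
  rw [lam_eq_sum, hs]
  have h1 : ∑ κ ∈ Finset.range N, (p : ℤ) ^ ((κ : ZMod n) - j).val * (dig p y κ : ℤ) ≡
      (p : ℤ) ^ (-j).val * y [ZMOD (p : ℤ) ^ n - 1] := by
    conv_rhs => rw [eq_sum_dig hy]
    push_cast
    rw [Finset.mul_sum]
    refine Int.ModEq.sum fun κ _ => ?_
    rw [mul_left_comm, mul_comm _ (dig p y κ : ℤ), ← pow_add]
    refine Int.ModEq.mul_left _ (pow_modEq_of_cast_eq ?_)
    push_cast
    rw [ZMod.natCast_zmod_val, ZMod.natCast_zmod_val]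
    ring
  exact (h1.dvd_iff).2 (h.mul_left _)

/-- A chain `0 = z 0 < ⋯ < z e` of multiples of `Q`, each digitwise below the next one, whose last
member is digitwise below `i`. -/
structure NumChain (p Q i e : ℕ) (z : ℕ → ℕ) : Prop where
  zero : z 0 = 0
  lt : ∀ a < e, z a < z (a + 1)
  digLE : ∀ a < e, DigLE p (z a) (z (a + 1))
  dvd : ∀ a ≤ e, Q ∣ z a
  top : DigLE p (z e) i

lemma NumChain.digLE_top {p Q i e : ℕ} {z : ℕ → ℕ} (h : NumChain p Q i e z) {a : ℕ} (ha : a ≤ e) :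
    DigLE p (z a) i := by
  induction ha using Nat.decreasingInduction with
  | self => exact h.top
  | of_succ a ha ih => exact (h.digLE a ha).trans ih

/-- The vector whose counts are the digit sums of `y` over residue classes. -/
def vecOf (p n N y : ℕ) (t : ZMod n) : ℤ :=
  lam p (fun t => (cum (dig p y) t N : ℤ)) t / ((p : ℤ) ^ n - 1)

section chains

variable {p n N i e : ℕ} [NeZero n]

lemma cnt_vecOf (hp : 2 ≤ p) {y : ℕ} (hy : y < p ^ N) (h : (p : ℤ) ^ n - 1 ∣ (y : ℤ))
    (t : ZMod n) : cnt p (vecOf p n N y) t = cum (dig p y) t N := by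
  have hp0 : (2 : ℤ) ≤ p := by exact_mod_cast hp
  have hQ : (0 : ℤ) < (p : ℤ) ^ n - 1 := by
    have := one_lt_pow₀ (by linarith : (1 : ℤ) < p) (NeZero.ne n)
    linarith
  have h1 := Int.ediv_mul_cancel (dvd_lam_cum hy h t)
  have h2 := Int.ediv_mul_cancel (dvd_lam_cum hy h (t + 1))
  have h3 := lam_succ (p := p) (fun t : ZMod n => (cum (dig p y) t N : ℤ)) t
  rw [← h1, ← h2] at h3
  apply mul_left_cancel₀ hQ.ne'
  rw [cnt, vecOf, vecOf]
  linarith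

lemma NumChain.fam (hp : 2 ≤ p) (hi : i < p ^ N) {z : ℕ → ℕ} (h : NumChain p (p ^ n - 1) i e z) :
    Fam p (fun t : ZMod n => (cum (dig p i) t N : ℤ)) e (fun a => vecOf p n N (z a)) ∧
      Nested (n := n) p e (fun a => vecOf p n N (z a)) ∧
      ∀ a ≤ e, ∀ t : ZMod n, cnt p (vecOf p n N (z a)) t = cum (dig p (z a)) t N := by
  have hlt : ∀ a ≤ e, z a < p ^ N := fun a ha => ((h.digLE_top ha).le hp).trans_lt hi
  have hdvd : ∀ a ≤ e, (p : ℤ) ^ n - 1 ∣ (z a : ℤ) := by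
    intro a ha
    have := Int.natCast_dvd_natCast.2 (h.dvd a ha)
    rwa [Nat.cast_sub (Nat.one_le_pow _ _ (by omega)), Nat.cast_pow, Nat.cast_one] at this
  have hcnt : ∀ a ≤ e, ∀ t : ZMod n, cnt p (vecOf p n N (z a)) t = cum (dig p (z a)) t N :=
    fun a ha t => cnt_vecOf hp (hlt a ha) (hdvd a ha) t
  have hnest : Nested (n := n) p e (fun a => vecOf p n N (z a)) := by
    intro a ha t
    simp only
    rw [hcnt a ha.le, hcnt (a + 1) ha]
    exact_mod_cast cum_le_cum (h.digLE a ha) t N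
  refine ⟨⟨?_, ?_, ?_, ?_⟩, hnest, hcnt⟩
  · funext t
    simp [h.zero, vecOf, cum, dig, lam]
  · intro a ha t
    by_contra hc
    have h1 := cnt_eq_of_le hp (hnest a ha) (t := t) (by simp only at hc ⊢; omega)
    have h2 : ∀ κ ∈ Finset.range N, dig p (z a) κ = dig p (z (a + 1)) κ := by
      rw [← Finset.sum_eq_sum_iff_of_le (fun κ _ => h.digLE a ha κ)]
      have h3 : ∀ t : ZMod n, cum (dig p (z a)) t N = cum (dig p (z (a + 1))) t N := by
        intro t
        have := h1 t
        simp only at this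
        rw [hcnt a ha.le, hcnt (a + 1) ha] at this
        exact_mod_cast this
      have h4 := sum_mul_cum (A := ℕ) (dig p (z a)) (fun _ : ZMod n => 1) N
      have h5 := sum_mul_cum (A := ℕ) (dig p (z (a + 1))) (fun _ : ZMod n => 1) N
      simp only [Nat.cast_id, one_mul] at h4 h5
      rw [← h4, ← h5]
      exact Finset.sum_congr rfl fun t _ => h3 t
    have h3 : z a = z (a + 1) := by
      rw [eq_sum_dig (hlt a ha.le), eq_sum_dig (hlt (a + 1) ha)]
      exact Finset.sum_congr rfl fun κ hκ => by rw [h2 κ hκ]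
    exact absurd (h.lt a ha) (by omega)
  · intro a ha t
    rw [hcnt a ha]
    positivity
  · intro a ha t
    rw [hcnt a ha]
    exact_mod_cast cum_le_cum (h.digLE_top ha) t N

/-- Among the chains below `i`, one with the smallest sum also has the smallest last member. -/
theorem NumChain.top_le (hp : 2 ≤ p) {z z' : ℕ → ℕ} (h : NumChain p (p ^ n - 1) i e z)
    (hmin : ∀ x, NumChain p (p ^ n - 1) i e x →
      ∑ a ∈ Finset.range (e + 1), z a ≤ ∑ a ∈ Finset.range (e + 1), x a)
    (h' : NumChain p (p ^ n - 1) i e z') : z e ≤ z' e := by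
  obtain ⟨N, hi⟩ : ∃ N, i < p ^ N := ⟨i, Nat.lt_pow_self (by omega)⟩
  set I : ℕ → ℕ := fun κ => if κ < N then dig p i κ else p - 1 with hIdef
  have hI : ∀ κ, I κ ≤ p - 1 := by
    intro κ
    simp only [hIdef]
    split_ifs
    · have := dig_lt hp i κ
      omega
    · exact le_rfl
  have hN : ∀ κ, N ≤ κ → 1 ≤ I κ := by
    intro κ hκ
    simp only [hIdef, if_neg (not_lt.2 hκ)]
    omega
  have hiI : ∀ κ, dig p i κ ≤ I κ := by
    intro κ
    simp only [hIdef]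
    split_ifs
    · exact le_rfl
    · have := dig_lt hp i κ
      omega
  have hcum : ∀ t : ZMod n, cum I t N = cum (dig p i) t N := by
    intro t
    refine Finset.sum_congr rfl fun κ hκ => ?_
    simp only [hIdef, if_pos (Finset.mem_range.1 hκ)]
  set R := rankingOf p n I N hI hN with hR
  set c : ZMod n → ℤ := fun t => (cum (dig p i) t N : ℤ) with hc
  have hweak : ∀ {x : ℕ → ℕ}, NumChain p (p ^ n - 1) i e x → ∀ a ≤ e,
      R.cost (vecOf p n N (x a)) ≤ x a := by
    intro x hx a ha
    have h1 := V_cum_le (n := n) hI hN hp (fun κ => (hx.digLE_top ha κ).trans (hiI κ)) N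
    rw [← eq_sum_dig (((hx.digLE_top ha).le hp).trans_lt hi)] at h1
    refine le_trans (le_of_eq ?_) h1
    rw [Ranking.cost]
    simp only [(hx.fam hp hi).2.2 a ha, Int.toNat_natCast]
    rfl
  have hnum : ∀ m, Fam p c e m → Nested p e m →
      NumChain p (p ^ n - 1) i e (fun a => R.cost (m a)) := by
    intro m hm hnm
    have hcap : ∀ a ≤ e, ∀ t, (cnt p (m a) t).toNat ≤ cum I t N := by
      intro a ha t
      have := hm.le a ha t
      rw [hcum]
      simp only [hc] at this
      omega
    refine ⟨?_, ?_, ?_, ?_, ?_⟩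
    · simp [hm.zero, Ranking.cost, Ranking.V_eq_sum, cnt]
    · intro a ha
      by_contra hge
      have h1 := R.cnt_eq_of_cost_le hp (hm.nonneg a ha.le) (hnm a ha) (not_lt.1 hge)
      have h2 := congrFun (cnt_injective hp h1) 0
      have := hm.step a ha 0
      omega
    · intro a ha
      exact digLE_V hI hN hp (fun t => Int.toNat_le_toNat (hnm a ha t)) (hcap (a + 1) ha)
    · intro a ha
      have h1 := R.V_modEq (fun t => (cnt p (m a) t).toNat)
      simp only [Int.toNat_of_nonneg (hm.nonneg a ha _)] at h1
      rw [show (fun t => cnt p (m a) t) = cnt p (m a) from rfl, lam_cnt] at h1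
      have h2 := h1.dvd_iff.2 (dvd_mul_right _ _)
      rw [← Int.natCast_dvd_natCast, Nat.cast_sub (Nat.one_le_pow _ _ (by omega)), Nat.cast_pow,
        Nat.cast_one]
      exact h2
    · intro κ
      rcases lt_or_ge κ N with hκ | hκ
      · have := dig_V_le (n := n) hI hN hp (hcap e le_rfl) κ
        simp only [hIdef, if_pos hκ] at this
        exact this
      · have h1 : R.cost (m e) < p ^ N := by
          apply R.sum_lt_pow hp
          intro x hx
          rw [Ranking.mem_tok] at hx
          rw [hR, rankingOf_pos_lt_iff]
          exact hx.trans_le (hcap e le_rfl _)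
        rw [dig_eq_zero hp h1 hκ]
        exact Nat.zero_le _
  obtain ⟨hf, hfn, -⟩ := h.fam (n := n) hp hi
  have hle := hweak h
  have hsum : ∑ a ∈ Finset.range (e + 1), R.cost (vecOf p n N (z a)) =
      ∑ a ∈ Finset.range (e + 1), z a :=
    le_antisymm (Finset.sum_le_sum fun a ha => hle a (by rw [Finset.mem_range] at ha; omega))
      (hmin _ (hnum _ hf hfn))
  have heq : R.cost (vecOf p n N (z e)) = z e :=
    (Finset.sum_eq_sum_iff_of_le
      (fun a ha => hle a (by rw [Finset.mem_range] at ha; omega))).1 hsum e (by simp)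
  rw [← heq]
  refine le_trans ?_ (hweak h' e le_rfl)
  refine R.cost_le_of_nested_min hp hf (fun m' hm' hn' => ?_) (h'.fam hp hi).1.feas_top
  exact hsum.le.trans (hmin _ (hnum m' hm' hn'))

end chains

lemma exists_forall_le_of_exists {α : Type*} {P : α → Prop} (f : α → ℕ) (h : ∃ a, P a) :
    ∃ a, P a ∧ ∀ b, P b → f a ≤ f b := by
  obtain ⟨a, ha, hmin⟩ := (measure f).wf.has_min {a | P a} h
  exact ⟨a, ha, fun b hb => not_lt.1 (hmin b hb)⟩

lemma Polynomial.degree_sum_eq_of_dominant {R ι : Type*} [Ring R] [DecidableEq ι]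
    {s : Finset ι} {f : ι → R[X]} {a : ι} (ha : a ∈ s) (h0 : f a ≠ 0)
    (h : ∀ b ∈ s, b ≠ a → f b = 0 ∨ (f b).natDegree < (f a).natDegree) :
    (∑ b ∈ s, f b).degree = (f a).degree := by
  rw [← Finset.add_sum_erase s f ha]
  apply degree_add_eq_left_of_degree_lt
  refine (degree_sum_le _ _).trans_lt ((Finset.sup_lt_iff ?_).2 ?_)
  · exact bot_lt_iff_ne_bot.2 (degree_ne_bot.2 h0)
  · intro b hb
    rw [Finset.mem_erase] at hb
    rcases h b hb.2 hb.1 with h1 | h1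
    · rw [h1, degree_zero]
      exact bot_lt_iff_ne_bot.2 (degree_ne_bot.2 h0)
    · exact degree_lt_degree h1

lemma FiniteField.sum_pow_eq_ite {F : Type*} [Field F] [Fintype F] (k : ℕ) :
    ∑ c : F, c ^ k = if 0 < k ∧ Fintype.card F - 1 ∣ k then -1 else 0 := by
  classical
  rcases Nat.eq_zero_or_pos k with rfl | hk
  · simp
  · have h1 : ∑ c : F, c ^ k = ∑ u : Fˣ, (u ^ k : F) := by
      rw [← Finset.add_sum_erase _ _ (Finset.mem_univ (0 : F)), zero_pow hk.ne', zero_add]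
      symm
      refine Finset.sum_bij (fun u _ => (u : F)) (by simp) (by simp [Units.ext_iff]) ?_ (by simp)
      intro b hb
      exact ⟨Units.mk0 b (Finset.ne_of_mem_erase hb), by simp, rfl⟩
    rw [h1, FiniteField.sum_pow_units]
    simp [hk]

/-- The power sum `∑ g ^ x` over all polynomials `g` of degree less than `e`, in recursive form. -/
noncomputable def lowSum (F : Type*) [Field F] [Fintype F] : ℕ → ℕ → F[X]
  | 0, x => if x = 0 then 1 else 0
  | e + 1, x => -∑ y ∈ (Finset.range x).filter fun y => Fintype.card F - 1 ∣ x - y,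
      (x.choose y : F[X]) * X ^ (e * (x - y)) * lowSum F e y

section

variable {F : Type*} [Field F]

/-- The polynomial with the given coefficients. -/
noncomputable def ofCoeffs {e : ℕ} (c : Fin e → F) : F[X] := ∑ j, C (c j) * X ^ (j : ℕ)

lemma ofCoeffs_snoc {e : ℕ} (c : Fin e → F) (a : F) :
    ofCoeffs (Fin.snoc c a : Fin (e + 1) → F) = C a * X ^ e + ofCoeffs c := by
  simp [ofCoeffs, Fin.sum_univ_castSucc, add_comm]

lemma sum_ofCoeffs_pow [Fintype F] (e x : ℕ) : ∑ c : Fin e → F, ofCoeffs c ^ x = lowSum F e x := by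
  induction e generalizing x with
  | zero => simp [ofCoeffs, lowSum, zero_pow_eq]
  | succ e ih =>
    rw [← (Fin.snocEquiv fun _ : Fin (e + 1) => F).sum_comp, Fintype.sum_prod_type]
    have h1 : ∀ (a : F) (c : Fin e → F),
        ofCoeffs ((Fin.snocEquiv fun _ : Fin (e + 1) => F) (a, c)) = ofCoeffs c + C a * X ^ e :=
      fun a c => (ofCoeffs_snoc c a).trans (add_comm _ _)
    simp only [h1, add_pow]
    simp only [Finset.sum_comm (s := Finset.univ) (t := Finset.range (x + 1))]
    rw [lowSum, Finset.sum_filter, ← Finset.sum_neg_distrib, Finset.sum_range_succ]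
    have h2 : ∀ y, ∑ a : F, ∑ c : Fin e → F,
        ofCoeffs c ^ y * (C a * X ^ e) ^ (x - y) * (x.choose y : F[X]) =
        C (∑ a : F, a ^ (x - y)) *
          ((x.choose y : F[X]) * X ^ (e * (x - y)) * lowSum F e y) := by
      intro y
      rw [map_sum, Finset.sum_mul]
      refine Finset.sum_congr rfl fun a _ => ?_
      rw [← ih, Finset.mul_sum, Finset.mul_sum]
      refine Finset.sum_congr rfl fun c _ => ?_
      rw [mul_pow, ← pow_mul, C_pow]
      ring
    simp only [h2, FiniteField.sum_pow_eq_ite]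
    rw [tsub_self, if_neg (by simp), C_0, zero_mul, add_zero]
    refine Finset.sum_congr rfl fun y hy => ?_
    have hy : 0 < x - y := Nat.sub_pos_of_lt (Finset.mem_range.1 hy)
    by_cases hd : Fintype.card F - 1 ∣ x - y
    · simp [hd, hy]
    · simp [hd]

lemma sum_monic_pow [Fintype F] (M : Finset F[X]) (e i : ℕ)
    (hM : ∀ f : F[X], f ∈ M ↔ f.Monic ∧ f.natDegree = e) :
    ∑ f ∈ M, f ^ i = ∑ y ∈ Finset.range (i + 1),
      (i.choose y : F[X]) * X ^ (e * (i - y)) * lowSum F e y := by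
  have hcoeff : ∀ (c : Fin e → F) (j : Fin e), (ofCoeffs c).coeff j = c j := by
    intro c j
    simp [ofCoeffs, coeff_X_pow, Fin.val_inj]
  have hdeg : ∀ c : Fin e → F, (ofCoeffs c).degree < e := by
    intro c
    refine (degree_sum_le _ _).trans_lt ((Finset.sup_lt_iff (WithBot.bot_lt_coe e)).2 ?_)
    intro j _
    exact (degree_C_mul_X_pow_le _ _).trans_lt (Nat.cast_lt.2 j.2)
  have h1 : ∑ c : Fin e → F, (ofCoeffs c + X ^ e) ^ i = ∑ f ∈ M, f ^ i := by
    refine Finset.sum_bij (fun c _ => ofCoeffs c + X ^ e) ?_ ?_ ?_ (fun _ _ => rfl)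
    · intro c _
      rw [hM, add_comm]
      exact ⟨monic_X_pow_add (hdeg c), by
        rw [natDegree_add_eq_left_of_degree_lt (by rw [degree_X_pow]; exact hdeg c),
          natDegree_X_pow]⟩
    · intro c _ c' _ h
      funext j
      rw [← hcoeff c, ← hcoeff c', add_right_cancel h]
    · intro f hf
      obtain ⟨hm, hd⟩ := (hM f).1 hf
      refine ⟨fun j => f.coeff j, Finset.mem_univ _, ?_⟩
      conv_rhs => rw [hm.as_sum, hd]
      rw [add_comm, ofCoeffs, Finset.sum_range]
  rw [← h1]
  simp only [add_pow]
  rw [Finset.sum_comm]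
  refine Finset.sum_congr rfl fun y _ => ?_
  rw [← sum_ofCoeffs_pow, Finset.mul_sum]
  refine Finset.sum_congr rfl fun c _ => ?_
  rw [← pow_mul]
  ring

end

/-- The nonvanishing and degree of `lowSum F e x` are governed by the chains ending at `x`. -/
structure LowSumSpec (F : Type*) [Field F] [Fintype F] (p Q e : ℕ) : Prop where
  exists_chain : ∀ x, lowSum F e x ≠ 0 → ∃ z, NumChain p Q x e z ∧ z e = x
  degree : ∀ x z, (NumChain p Q x e z ∧ z e = x) →
    (∀ z', (NumChain p Q x e z' ∧ z' e = x) →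
      ∑ a ∈ Finset.range (e + 1), z a ≤ ∑ a ∈ Finset.range (e + 1), z' a) →
    lowSum F e x ≠ 0 ∧ (lowSum F e x).natDegree + ∑ a ∈ Finset.range (e + 1), z a = e * x

lemma digLE_refl (p x : ℕ) : DigLE p x x := fun _ => le_rfl

lemma NumChain.ending {p Q i e : ℕ} {z : ℕ → ℕ} (h : NumChain p Q i e z) :
    NumChain p Q (z e) e z :=
  ⟨h.zero, h.lt, h.digLE, h.dvd, digLE_refl p _⟩

lemma NumChain.of_digLE {p Q i j e : ℕ} {z : ℕ → ℕ} (h : NumChain p Q i e z)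
    (hij : DigLE p i j) : NumChain p Q j e z :=
  ⟨h.zero, h.lt, h.digLE, h.dvd, h.top.trans hij⟩

lemma NumChain.truncate {p Q i e : ℕ} {z : ℕ → ℕ} (h : NumChain p Q i (e + 1) z) :
    NumChain p Q i e z :=
  ⟨h.zero, fun a ha => h.lt a (by omega), fun a ha => h.digLE a (by omega),
    fun a ha => h.dvd a (by omega), h.digLE_top (Nat.le_succ e)⟩

lemma NumChain.extend {p Q x e : ℕ} {z : ℕ → ℕ} (h : NumChain p Q x e z) (hlt : z e < x)
    (hdvd : Q ∣ x) : NumChain p Q x (e + 1) (Function.update z (e + 1) x) := by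
  have h1 : ∀ a ≤ e, Function.update z (e + 1) x a = z a := fun a ha =>
    Function.update_of_ne (by omega) _ _
  have h2 : Function.update z (e + 1) x (e + 1) = x := Function.update_self _ _ _
  refine ⟨by rw [h1 0 (Nat.zero_le _), h.zero], ?_, ?_, ?_, by rw [h2]; exact digLE_refl p x⟩
  · intro a ha
    rcases Nat.lt_succ_iff_lt_or_eq.1 ha with ha | rfl
    · rw [h1 a ha.le, h1 (a + 1) ha]
      exact h.lt a ha
    · rwa [h1 a le_rfl, h2]
  · intro a ha
    rcases Nat.lt_succ_iff_lt_or_eq.1 ha with ha | rfl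
    · rw [h1 a ha.le, h1 (a + 1) ha]
      exact h.digLE a ha
    · rw [h1 a le_rfl, h2]
      exact h.top
  · intro a ha
    rcases Nat.le_succ_iff.1 ha with ha | rfl
    · rw [h1 a ha]
      exact h.dvd a ha
    · rwa [h2]

lemma natCast_choose_ne_zero_iff {F : Type*} [Field F] {p : ℕ} [CharP F p] (hp : p.Prime) (x y : ℕ) :
    (x.choose y : F[X]) ≠ 0 ↔ DigLE p y x := by
  rw [← not_dvd_choose_iff hp, Ne, CharP.cast_eq_zero_iff F[X] p]

section

variable {F : Type*} [Field F] [Fintype F] {p n e : ℕ} [NeZero n] [CharP F p]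

lemma LowSumSpec.sum_ne_zero (hp : p.Prime) (hS : LowSumSpec F p (p ^ n - 1) e) {i : ℕ}
    {z : ℕ → ℕ} (hz : NumChain p (p ^ n - 1) i e z)
    (hmin : ∀ x, NumChain p (p ^ n - 1) i e x →
      ∑ a ∈ Finset.range (e + 1), z a ≤ ∑ a ∈ Finset.range (e + 1), x a)
    {s : Finset ℕ} (hzs : z e ∈ s) (hs : ∀ y ∈ s, y ≤ i) :
    ∑ y ∈ s, (i.choose y : F[X]) * X ^ (e * (i - y)) * lowSum F e y ≠ 0 ∧
      (∑ y ∈ s, (i.choose y : F[X]) * X ^ (e * (i - y)) * lowSum F e y).natDegree +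
        ∑ a ∈ Finset.range (e + 1), z a = e * i := by
  have hdeg : ∀ y ∈ s, DigLE p y i → lowSum F e y ≠ 0 →
      ((i.choose y : F[X]) * X ^ (e * (i - y)) * lowSum F e y).natDegree =
        e * (i - y) + (lowSum F e y).natDegree := by
    intro y hy hyi h0
    have h1 := (natCast_choose_ne_zero_iff (F := F) hp i y).2 hyi
    rw [natDegree_mul (mul_ne_zero h1 (pow_ne_zero _ X_ne_zero)) h0,
      natDegree_mul h1 (pow_ne_zero _ X_ne_zero), natDegree_natCast, natDegree_X_pow, zero_add]
  have hsplit : ∀ y ∈ s, e * (i - y) + e * y = e * i := by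
    intro y hy
    rw [← mul_add, Nat.sub_add_cancel (hs y hy)]
  obtain ⟨hz0, hzd⟩ := hS.degree (z e) z ⟨hz.ending, rfl⟩
    (fun z' hz' => hmin z' (hz'.1.of_digLE hz.top))
  have hzt := hdeg _ hzs hz.top hz0
  have hne : (i.choose (z e) : F[X]) * X ^ (e * (i - z e)) * lowSum F e (z e) ≠ 0 :=
    mul_ne_zero (mul_ne_zero ((natCast_choose_ne_zero_iff hp _ _).2 hz.top)
      (pow_ne_zero _ X_ne_zero)) hz0
  have key := Polynomial.degree_sum_eq_of_dominant
    (f := fun y => (i.choose y : F[X]) * X ^ (e * (i - y)) * lowSum F e y) hzs hne ?_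
  · refine ⟨fun h => hne ?_, ?_⟩
    · rw [h, degree_zero] at key
      exact degree_eq_bot.1 key.symm
    · rw [natDegree_eq_of_degree_eq key]
      have := hsplit _ hzs
      omega
  · intro y hy hyz
    by_cases hyi : DigLE p y i
    · by_cases h0 : lowSum F e y = 0
      · left
        simp only [h0, mul_zero]
      · right
        obtain ⟨w, hw, hwmin⟩ := exists_forall_le_of_exists
          (fun w : ℕ → ℕ => ∑ a ∈ Finset.range (e + 1), w a) (hS.exists_chain y h0)
        have hwi := hw.1.of_digLE hyi
        have hlt : ∑ a ∈ Finset.range (e + 1), z a < ∑ a ∈ Finset.range (e + 1), w a := by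
          refine lt_of_le_of_ne (hmin w hwi) fun heq => hyz ?_
          rw [← hw.2]
          exact le_antisymm
            (hwi.top_le hp.two_le (fun x hx => heq ▸ hmin x hx) hz)
            (hz.top_le hp.two_le hmin hwi)
        have h1 := (hS.degree y w hw hwmin).2
        have h2 := hsplit y hy
        have h3 := hsplit _ hzs
        have h4 := hdeg y hy hyi h0
        omega
    · left
      have := not_not.1 (mt (natCast_choose_ne_zero_iff (F := F) hp i y).1 hyi)
      simp only [this, zero_mul]

lemma lowSumSpec (hp : p.Prime) (hF : Fintype.card F = p ^ n) (e : ℕ) :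
    LowSumSpec F p (p ^ n - 1) e := by
  induction e with
  | zero =>
    refine ⟨fun x hx => ?_, fun x z hz _ => ?_⟩
    · have h0 : x = 0 := by
        by_contra h
        exact hx (by simp [lowSum, h])
      exact ⟨fun _ => 0, ⟨rfl, by simp, by simp, by simp, by rw [h0]; exact digLE_refl p 0⟩,
        h0.symm⟩
    · have h0 : x = 0 := by rw [← hz.2, hz.1.zero]
      simp [lowSum, h0, hz.1.zero]
  | succ e ih =>
    refine ⟨fun x hx => ?_, fun x z hz hmin => ?_⟩
    · rw [lowSum, neg_ne_zero] at hx
      obtain ⟨y, hy, hne⟩ := Finset.exists_ne_zero_of_sum_ne_zero hx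
      rw [Finset.mem_filter, Finset.mem_range, hF] at hy
      obtain ⟨z, hz, hzy⟩ := ih.exists_chain y (right_ne_zero_of_mul hne)
      have hyx := (natCast_choose_ne_zero_iff (F := F) hp x y).1
        (left_ne_zero_of_mul (left_ne_zero_of_mul hne))
      refine ⟨_, (hz.of_digLE hyx).extend (by omega) ?_, Function.update_self _ _ _⟩
      have h1 := hz.dvd e le_rfl
      rw [hzy] at h1
      have h2 := dvd_add hy.2 h1
      rwa [Nat.sub_add_cancel hy.1.le] at h2
    · obtain ⟨w, hw, hwmin⟩ := exists_forall_le_of_exists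
        (fun w : ℕ → ℕ => ∑ a ∈ Finset.range (e + 1), w a) ⟨z, hz.1.truncate⟩
      have hzx : z e < x := hz.2 ▸ hz.1.lt e (Nat.lt_succ_self e)
      have hwx : w e < x := (hw.top_le hp.two_le hwmin hz.1.truncate).trans_lt hzx
      have hQx : p ^ n - 1 ∣ x := hz.2 ▸ hz.1.dvd (e + 1) le_rfl
      obtain ⟨h1, h2⟩ := ih.sum_ne_zero hp hw hwmin
        (s := (Finset.range x).filter fun y => Fintype.card F - 1 ∣ x - y)
        (Finset.mem_filter.2 ⟨Finset.mem_range.2 hwx, hF ▸ Nat.dvd_sub hQx (hw.dvd e le_rfl)⟩)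
        (fun y hy => (Finset.mem_range.1 (Finset.mem_filter.1 hy).1).le)
      rw [lowSum, natDegree_neg, neg_ne_zero]
      refine ⟨h1, ?_⟩
      have h3 := hmin _ ⟨hw.extend hwx hQx, Function.update_self _ _ _⟩
      rw [Finset.sum_range_succ, Finset.sum_range_succ _ (e + 1), Function.update_self,
        hz.2] at h3
      rw [Finset.sum_congr rfl fun a ha => Function.update_of_ne
        (Finset.mem_range.1 ha).ne _ _] at h3
      have h4 := hwmin z hz.1.truncate
      rw [Finset.sum_range_succ, hz.2, add_mul, one_mul]
      omega

end

/-- if the power sum `S_e(i) = Σ_{f monic, deg f = e} f^i` over `F_q[T]`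
vanishes, then so does `S_{e+1}(i)`.  Here `M e` is the finite set of monic polynomials
of degree `e`. -/
theorem powerSum_zero_of_succ (p q : ℕ) (hp : p.Prime)
    (hq : ∃ n : ℕ, 0 < n ∧ q = p ^ n)
    (F : Type*) [Field F] [Fintype F] (hF : Fintype.card F = q)
    (M : ℕ → Finset (Polynomial F))
    (hM : ∀ (e : ℕ) (f : Polynomial F), f ∈ M e ↔ f.Monic ∧ f.natDegree = e)
    (e i : ℕ) (h : ∑ f ∈ M e, f ^ i = 0) :
    ∑ f ∈ M (e + 1), f ^ i = 0 := by
  obtain ⟨n, hn, rfl⟩ := hq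
  have : NeZero n := ⟨hn.ne'⟩
  have : Fact p.Prime := ⟨hp⟩
  have : CharP F p := charP_of_card_eq_prime_pow hF
  rw [sum_monic_pow (M e) e i (hM e)] at h
  rw [sum_monic_pow (M (e + 1)) (e + 1) i (hM (e + 1))]
  by_contra hne
  obtain ⟨y, -, hy⟩ := Finset.exists_ne_zero_of_sum_ne_zero hne
  obtain ⟨z, hz, -⟩ := (lowSumSpec hp hF (e + 1)).exists_chain y (right_ne_zero_of_mul hy)
  have hyi := (natCast_choose_ne_zero_iff (F := F) hp i y).1
    (left_ne_zero_of_mul (left_ne_zero_of_mul hy))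
  obtain ⟨w, hw, hwmin⟩ := exists_forall_le_of_exists
    (fun w : ℕ → ℕ => ∑ a ∈ Finset.range (e + 1), w a) ⟨z, (hz.of_digLE hyi).truncate⟩
  refine ((lowSumSpec hp hF e).sum_ne_zero hp hw hwmin (Finset.mem_range.2 ?_) ?_).1 h
  · exact Nat.lt_succ_of_le (hw.top.le hp.two_le)
  · exact fun y hy => Nat.lt_succ_iff.1 (Finset.mem_range.1 hy)
end

section
/- Let p be an odd prime and n a positive even integer not divisible by p − 1, and suppose B_n ≠ 0. Then v_p(B_n) ≥ v_p(n), where v_p denotes the p-adic valuation. -/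
open Finset in
/-- Multiplication by `a` coprime to `N` permutes the residues modulo `N`. -/
theorem sum_range_mul_mod_of_coprime {M : Type*} [AddCommMonoid M] {a N : ℕ}
    (h : a.Coprime N) (f : ℕ → M) :
    ∑ x ∈ range N, f (a * x % N) = ∑ x ∈ range N, f x := by
  have hinj : Set.InjOn (fun x => a * x % N) (range N) := by
    intro x hx y hy hxy
    have hmod : x ≡ y [MOD N] :=
      Nat.ModEq.cancel_left_of_coprime (Nat.Coprime.symm h) hxy
    exact hmod.eq_of_lt_of_lt (by simpa using hx) (by simpa using hy)
  have himage : (range N).image (fun x => a * x % N) = range N := by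
    refine eq_of_subset_of_card_le ?_ (card_image_of_injOn hinj).ge
    intro y hy
    obtain ⟨x, hx, rfl⟩ := mem_image.mp hy
    exact mem_range.mpr (Nat.mod_lt _ (Nat.zero_lt_of_lt (mem_range.mp hx)))
  rw [← sum_image (f := f) hinj, himage]

/-- Raising to the `p ^ k`-th power improves a congruence modulo `p ^ m` by `k` powers of `p`. -/
theorem Int.pow_add_dvd_pow_sub_pow {p m : ℕ} (hm : m ≠ 0) {x y : ℤ}
    (h : (p : ℤ) ^ m ∣ x - y) (k : ℕ) :
    (p : ℤ) ^ (m + k) ∣ x ^ p ^ k - y ^ p ^ k := by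
  induction k with
  | zero => simpa using h
  | succ k ih =>
    rw [pow_succ p k, pow_mul, pow_mul, ← add_assoc, pow_succ, ← geom_sum₂_mul, mul_comm]
    refine mul_dvd_mul ?_ ih
    have hp : (p : ℤ) ∣ x ^ p ^ k - y ^ p ^ k := (dvd_pow_self _ (by lia)).trans ih
    exact (dvd_geom_sum₂_iff_of_dvd_sub hp).mpr (by simp)

open Finset in
/-- Faulhaber's formula modulo `N ^ 2`, with a common denominator `D`. -/
theorem exists_mul_sum_range_pow_eq (n : ℕ) :
    ∃ D b : ℤ, D ≠ 0 ∧ (b : ℚ) = D * bernoulli n ∧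
      ∀ N : ℕ, ∃ z : ℤ, D * ∑ x ∈ range N, (x : ℤ) ^ n = b * N + N ^ 2 * z := by
  obtain ⟨D, hD⟩ := IsLocalization.exist_integer_multiples_of_finset (nonZeroDivisors ℤ)
    ((range (n + 1)).image fun i => bernoulli i * ((n + 1).choose i : ℚ) / (n + 1))
  have hc (i : ℕ) : ∃ c : ℤ, i ∈ range (n + 1) →
      (c : ℚ) = D * (bernoulli i * ((n + 1).choose i : ℚ) / (n + 1)) := by
    by_cases hi : i ∈ range (n + 1)
    · obtain ⟨c, hc⟩ := hD _ (mem_image_of_mem _ hi)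
      exact ⟨c, fun _ => by simpa [Algebra.smul_def] using hc⟩
    · exact ⟨0, fun h => absurd h hi⟩
  choose c hc using hc
  have hn : (n + 1 : ℚ) ≠ 0 := by positivity
  refine ⟨D, c n, nonZeroDivisors.coe_ne_zero D, ?_, fun N =>
    ⟨∑ i ∈ range n, c i * (N : ℤ) ^ (n - 1 - i), ?_⟩⟩
  · rw [hc n (self_mem_range_succ n), Nat.choose_succ_self_right]
    push_cast
    field_simp
  · have hsum : (D : ℤ) * ∑ x ∈ range N, (x : ℤ) ^ n =
        ∑ i ∈ range (n + 1), c i * (N : ℤ) ^ (n + 1 - i) := by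
      have : ((D : ℤ) : ℚ) * ∑ x ∈ range N, (x : ℚ) ^ n =
          ∑ i ∈ range (n + 1), c i * (N : ℚ) ^ (n + 1 - i) := by
        rw [sum_range_pow, mul_sum]
        refine sum_congr rfl fun i hi => ?_
        rw [hc i hi]
        ring
      exact_mod_cast this
    rw [hsum, sum_range_succ, mul_sum, add_comm, Nat.add_sub_cancel_left, pow_one]
    congr 1
    refine sum_congr rfl fun i hi => ?_
    have hi := mem_range.mp hi
    rw [show n + 1 - i = 2 + (n - 1 - i) by lia, pow_add]
    ring

open Finset in
/-- Power sums up to `p ^ m` are nearly invariant under scaling by a unit modulo `p`. -/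
theorem pow_add_padicValNat_dvd_sub_one_mul_sum_range_pow {p a m : ℕ} (n : ℕ) (hm : m ≠ 0)
    (ha : a.Coprime p) :
    (p : ℤ) ^ (m + padicValNat p n) ∣
      ((a : ℤ) ^ n - 1) * ∑ x ∈ range (p ^ m), (x : ℤ) ^ n := by
  rw [sub_mul, one_mul, mul_sum,
    ← sum_range_mul_mod_of_coprime (ha.pow_right m) fun x => (x : ℤ) ^ n, ← sum_sub_distrib]
  refine dvd_sum fun x _ => ?_
  have hx : (p : ℤ) ^ m ∣ a * x - ((a * x % p ^ m : ℕ) : ℤ) := by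
    push_cast
    exact Int.dvd_self_sub_emod
  obtain ⟨l, hl⟩ : p ^ padicValNat p n ∣ n := pow_padicValNat_dvd
  rw [← mul_pow]
  refine (Int.pow_add_dvd_pow_sub_pow hm hx (padicValNat p n)).trans ?_
  conv_rhs => rw [hl, pow_mul, pow_mul]
  exact sub_dvd_pow_sub_pow _ _ l

/-- If `p - 1 ∤ n`, some `a` prime to `p` has `a ^ n ≢ 1` modulo `p`. -/
theorem Nat.Prime.exists_coprime_not_dvd_pow_sub_one {p n : ℕ} (hp : p.Prime)
    (hn : ¬ (p - 1) ∣ n) : ∃ a : ℕ, a.Coprime p ∧ ¬ (p : ℤ) ∣ (a : ℤ) ^ n - 1 := by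
  have : Fact p.Prime := ⟨hp⟩
  have hu : ¬ ∀ u : (ZMod p)ˣ, u ^ n = 1 := by
    rwa [FiniteField.forall_pow_eq_one_iff, ZMod.card]
  push Not at hu
  obtain ⟨u, hu⟩ := hu
  refine ⟨(u : ZMod p).val, ZMod.val_coe_unit_coprime u, fun h => hu ?_⟩
  rw [← ZMod.intCast_zmod_eq_zero_iff_dvd] at h
  ext
  simpa [sub_eq_zero] using h

/-- consequence of the Adams congruences: for an odd prime `p` and a
positive even integer `n` not divisible by `p − 1` with `B_n ≠ 0`, one has
`v_p(B_n) ≥ v_p(n)`. -/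
theorem padicValRat_bernoulli_ge (p : ℕ) (hp : p.Prime) (hodd : Odd p)
    (n : ℕ) (hn : 0 < n) (hne : Even n) (hnd : ¬ (p - 1) ∣ n)
    (hB : bernoulli n ≠ 0) :
    (padicValNat p n : ℤ) ≤ padicValRat p (bernoulli n) := by
  have : Fact p.Prime := ⟨hp⟩
  obtain ⟨a, hap, han⟩ := hp.exists_coprime_not_dvd_pow_sub_one hnd
  obtain ⟨D, b, hD, hb, hsum⟩ := exists_mul_sum_range_pow_eq n
  set v := padicValNat p n
  set d := padicValInt p D
  set m := v + d + 1
  obtain ⟨z, hz⟩ := hsum (p ^ m)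
  have hDb : (p : ℤ) ^ m * (p : ℤ) ^ (v + d) ∣
      (p : ℤ) ^ m * (((a : ℤ) ^ n - 1) * (b + (p : ℤ) ^ m * z)) := by
    have h : (p : ℤ) ^ d * (p : ℤ) ^ (m + v) ∣
        D * (((a : ℤ) ^ n - 1) * ∑ x ∈ Finset.range (p ^ m), (x : ℤ) ^ n) :=
      mul_dvd_mul (padicValInt_dvd D)
        (pow_add_padicValNat_dvd_sub_one_mul_sum_range_pow n (Nat.succ_ne_zero (v + d)) hap)
    rw [mul_left_comm, hz, Nat.cast_pow, ← pow_add] at h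
    rw [← pow_add, show m + (v + d) = d + (m + v) by lia]
    exact h.trans (dvd_of_eq (by ring))
  have hpb : (p : ℤ) ^ (v + d) ∣ b := by
    have h := IsCoprime.dvd_of_dvd_mul_left
      (((Nat.prime_iff_prime_int.mp hp).coprime_iff_not_dvd.mpr han).pow_left)
      (Int.dvd_of_mul_dvd_mul_left (pow_ne_zero m (by exact_mod_cast hp.ne_zero)) hDb)
    exact (dvd_add_left ((pow_dvd_pow _ (Nat.le_succ _)).mul_right z)).mp h
  have hD' : (D : ℚ) ≠ 0 := by exact_mod_cast hD
  have hb0 : b ≠ 0 := by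
    have : (b : ℚ) ≠ 0 := hb ▸ mul_ne_zero hD' hB
    exact_mod_cast this
  have hle : v + d ≤ padicValInt p b := ((padicValInt_dvd_iff _ b).mp hpb).resolve_left hb0
  have hval := congrArg (padicValRat p) hb
  rw [padicValRat.mul hD' hB, padicValRat.of_int, padicValRat.of_int] at hval
  lia
end
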